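/- arXiv:2510.00889 — 2 statements merged into one kernel-verified Lean document; each statement's English description precedes it below -/
import Mathlib

section
/- Let λ be the largest real root of the polynomial λ⁴ − 3λ³ + λ² + λ − 1 (so λ ≈ 2.505). Then for every ε > 0 there exists a constant C > 0 such that for every n, the number of potentially positive elements of F_2 whose reduced word has length n is at most C·(λ + ε)^n. -/
/-- `FG r` is the free group `F_r` of rank `r`, with free generating set
`x_1, …, x_r` given by `FreeGroup.of 0, …, FreeGroup.of (r-1)`. -/
abbrev FG (r : ℕ) := FreeGroup (Fin r)

/-- `|w|`, the length of the reduced word representing `w`. -/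
def wordLength {r : ℕ} (w : FG r) : ℕ := w.toWord.length

/-- `w` is cyclically reduced: its reduced word is empty, or its first letter is not
the inverse of its last letter.  (A letter `(i, b)` has inverse `(i, !b)`.) -/
def CyclicallyReduced {r : ℕ} (w : FG r) : Prop :=
  ∀ a ∈ w.toWord.head?, ∀ b ∈ w.toWord.getLast?, a ≠ (b.1, !b.2)

/-- `p` is a primitive element of `F_r`: the image of `x_1` under some automorphism. -/
def Primitive {r : ℕ} (hr : 0 < r) (p : FG r) : Prop :=
  ∃ φ : FG r ≃* FG r, φ (FreeGroup.of ⟨0, hr⟩) = p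

/-- `v` is primitivity-blocking: the reduced word of `v` is not an infix of the reduced
word of any cyclically reduced primitive element of `F_r`. -/
def PrimitivityBlocking {r : ℕ} (hr : 0 < r) (v : FG r) : Prop :=
  ∀ p : FG r, Primitive hr p → CyclicallyReduced p → ¬ v.toWord <:+: p.toWord

/-- `v` is `w`-orbit-blocking: for every automorphism `φ` with `φ w` cyclically reduced,
the reduced word of `v` is not an infix of the reduced word of `φ w`. -/
def OrbitBlocking {r : ℕ} (w v : FG r) : Prop :=
  ∀ φ : FG r ≃* FG r, CyclicallyReduced (φ w) → ¬ v.toWord <:+: (φ w).toWord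

/-- `u` is positive: every letter of its reduced word is a generator (not an inverse). -/
def Positive {r : ℕ} (u : FG r) : Prop := ∀ l ∈ u.toWord, l.2 = true

/-- The cyclic length `‖u‖`: the minimum of `|g u g⁻¹|` over all `g`. -/
noncomputable def cyclicLength {r : ℕ} (u : FG r) : ℕ :=
  sInf (Set.range fun g : FG r => wordLength (g * u * g⁻¹))

/-- `gen r j` is the generator `x_{j+1}` of `F_r` (0-indexed: the `j`-th generator),
for `j < r`. -/
def gen (r : ℕ) (j : ℕ) : FG r :=
  if h : j < r then FreeGroup.of ⟨j, h⟩ else 1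

/-- `(b_1, …, b_r)` is a basis of `F_r`: some automorphism sends `x_i` to `b_i`. -/
def IsBasis {r : ℕ} (b : Fin r → FG r) : Prop :=
  ∃ φ : FG r ≃* FG r, ∀ i, φ (FreeGroup.of i) = b i

namespace FreeGroup

variable {α : Type*} [DecidableEq α]

/-- The length of the longest common prefix of two lists. -/
def commonPrefix {β : Type*} [DecidableEq β] : List β → List β → ℕ
  | a :: l, b :: m => if a = b then commonPrefix l m + 1 else 0
  | _, _ => 0

theorem commonPrefix_ultrametric {β : Type*} [DecidableEq β] (l m n : List β) :
    min (commonPrefix l m) (commonPrefix m n) ≤ commonPrefix l n := by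
  induction l generalizing m n with
  | nil => simp [commonPrefix]
  | cons a l ih =>
    cases m with
    | nil => simp [commonPrefix]
    | cons b m =>
      cases n with
      | nil => simp [commonPrefix]
      | cons c n =>
        have := ih m n
        simp only [commonPrefix]
        split_ifs <;> simp_all

theorem commonPrefix_comm {β : Type*} [DecidableEq β] (l m : List β) :
    commonPrefix l m = commonPrefix m l := by
  induction l generalizing m with
  | nil => cases m <;> simp [commonPrefix]
  | cons a l ih =>
    cases m with
    | nil => simp [commonPrefix]
    | cons b m => simp only [commonPrefix, ih m, eq_comm]

theorem exists_eq_append_of_commonPrefix {β : Type*} [DecidableEq β] (l m : List β) :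
    ∃ s l' m', s.length = commonPrefix l m ∧ l = s ++ l' ∧ m = s ++ m' := by
  induction l generalizing m with
  | nil => exact ⟨[], [], m, by simp [commonPrefix]⟩
  | cons a l ih =>
    cases m with
    | nil => exact ⟨[], a :: l, [], by simp [commonPrefix]⟩
    | cons b m =>
      by_cases h : a = b
      · obtain ⟨s, l', m', h1, h2, h3⟩ := ih m
        exact ⟨a :: s, l', m', by simp [commonPrefix, h, h1], by simp [h2], by simp [h3, h]⟩
      · exact ⟨[], a :: l, b :: m, by simp [commonPrefix, h]⟩

theorem isReduced_invRev {l : List (α × Bool)} (h : IsReduced l) : IsReduced (invRev l) := by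
  rw [isReduced_iff_reduce_eq] at *
  rw [reduce_invRev, h]

theorem norm_mk_of_isReduced {l : List (α × Bool)} (h : IsReduced l) :
    (mk l).norm = l.length := by
  rw [norm, toWord_mk, h.reduce_eq]

theorem norm_mk_invRev_append {l m : List (α × Bool)} (hl : IsReduced l) (hm : IsReduced m) :
    (mk (invRev l ++ m)).norm + 2 * commonPrefix l m = l.length + m.length := by
  induction l generalizing m with
  | nil => simp [commonPrefix, norm_mk_of_isReduced hm]
  | cons a l ih =>
    cases m with
    | nil => simpa [commonPrefix] using norm_mk_of_isReduced (isReduced_invRev hl)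
    | cons b m =>
      by_cases h : a = b
      · subst h
        have h1 : mk (invRev (a :: l) ++ a :: m) = mk (invRev l ++ m) := by
          simp only [← mul_mk, ← inv_mk]
          rw [← List.singleton_append, ← List.singleton_append (l := m), ← mul_mk, ← mul_mk]
          group
        have := ih (m := m) (List.IsChain.of_cons hl) (List.IsChain.of_cons hm)
        simp only [commonPrefix, if_true, h1, List.length_cons]
        omega
      · have h2 : IsReduced (invRev (a :: l) ++ b :: m) := by
          refine List.IsChain.append (isReduced_invRev hl) hm ?_
          intro u hu v hv
          rw [invRev_cons] at hu
          simp [invRev] at hu hv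
          subst hu hv
          intro h3
          by_contra h4
          exact h (Prod.ext h3 (by cases h5 : a.2 <;> cases h6 : b.2 <;> simp_all))
        rw [norm_mk_of_isReduced h2]
        simp [commonPrefix, h]

theorem norm_inv_mul_add (a b : FreeGroup α) :
    (a⁻¹ * b).norm + 2 * commonPrefix a.toWord b.toWord = a.norm + b.norm := by
  have := norm_mk_invRev_append (isReduced_toWord (x := a)) (isReduced_toWord (x := b))
  rwa [← mul_mk, ← inv_mk, mk_toWord, mk_toWord] at this

/-- The length of the initial segment shared by the reduced words of `a` and `b`. -/
def overlap (a b : FreeGroup α) : ℕ := commonPrefix a.toWord b.toWord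

theorem norm_mul_add (a b : FreeGroup α) :
    (a * b).norm + 2 * overlap a⁻¹ b = a.norm + b.norm := by
  have := norm_inv_mul_add a⁻¹ b
  rwa [inv_inv, norm_inv_eq] at this

theorem overlap_comm (a b : FreeGroup α) : overlap a b = overlap b a := commonPrefix_comm _ _

theorem overlap_ultrametric (a b c : FreeGroup α) :
    min (overlap a b) (overlap b c) ≤ overlap a c := commonPrefix_ultrametric _ _ _

theorem two_mul_overlap_inv_lt {a : FreeGroup α} (ha : a ≠ 1) : 2 * overlap a⁻¹ a < a.norm := by
  by_contra! h
  obtain ⟨s, l, m, h1, h2, h3⟩ := exists_eq_append_of_commonPrefix a⁻¹.toWord a.toWord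
  have h4 : a.toWord = invRev l ++ invRev s := by
    rw [← invRev_append, ← h2, toWord_inv, invRev_invRev]
  have hs : 2 * s.length ≥ a.norm := by rw [h1]; exact h
  have hn : a.norm = s.length + m.length := by rw [norm, h3, List.length_append]
  have hn' : a.norm = l.length + s.length := by
    rw [norm, h4, List.length_append, invRev_length, invRev_length]
  have hp : (invRev l) <+: s :=
    List.prefix_of_prefix_length_le ⟨invRev s, h4.symm⟩ ⟨m, h3.symm⟩ (by rw [invRev_length]; omega)
  obtain ⟨r, hr⟩ := hp
  have h5 : a.toWord = invRev l ++ (r ++ m) := by rw [h3, ← hr, List.append_assoc]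
  have h6 : invRev s = r ++ m := List.append_cancel_left (h4.symm.trans h5)
  have h7 : invRev s = invRev r ++ l := by rw [← hr, invRev_append, invRev_invRev]
  have h8 : r = invRev r :=
    List.append_inj_left (h6.symm.trans h7) (by rw [invRev_length])
  have h9 : (mk r) * mk r = 1 := by
    nth_rewrite 1 [h8]
    rw [← inv_mk, inv_mul_cancel]
  have h10 : mk r = 1 := by
    have := (pow_eq_one_iff_left (a := mk r) (two_ne_zero)).1 (by rw [pow_two, h9])
    exact this
  apply ha
  rw [← mk_toWord (x := a), h4, ← mul_mk, ← hr, invRev_append, ← mul_mk, ← inv_mk (L := r), h10,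
    inv_one, one_mul, invRev_invRev, ← inv_mk, inv_mul_cancel]

theorem mulAut_ext {φ ψ : MulAut (FG 2)} (h0 : φ (of 0) = ψ (of 0))
    (h1 : φ (of 1) = ψ (of 1)) : φ = ψ := by
  apply MulEquiv.toMonoidHom_injective
  apply FreeGroup.ext_hom
  intro i
  fin_cases i
  · exact h0
  · exact h1

/-- The automorphism of `F_2` exchanging the two generators. -/
def swapAut : MulAut (FG 2) :=
  MonoidHom.toMulEquiv (lift ![of 1, of 0]) (lift ![of 1, of 0])
    (by ext i; fin_cases i <;> simp) (by ext i; fin_cases i <;> simp)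

/-- The automorphism of `F_2` inverting the second generator. -/
def invAut : MulAut (FG 2) :=
  MonoidHom.toMulEquiv (lift ![of 0, (of 1)⁻¹]) (lift ![of 0, (of 1)⁻¹])
    (by ext i; fin_cases i <;> simp) (by ext i; fin_cases i <;> simp)

/-- The automorphism `x ↦ x`, `y ↦ x y` of `F_2`. -/
def mulLeftAut : MulAut (FG 2) :=
  MonoidHom.toMulEquiv (lift ![of 0, of 0 * of 1]) (lift ![of 0, (of 0)⁻¹ * of 1])
    (by ext i; fin_cases i <;> simp) (by ext i; fin_cases i <;> simp)

@[simp] theorem swapAut_zero : swapAut (of 0) = of 1 := by simp [swapAut]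
@[simp] theorem swapAut_one : swapAut (of 1) = of 0 := by simp [swapAut]
@[simp] theorem invAut_zero : invAut (of 0) = of 0 := by simp [invAut]
@[simp] theorem invAut_one : invAut (of 1) = (of 1)⁻¹ := by simp [invAut]
@[simp] theorem mulLeftAut_zero : mulLeftAut (of 0) = of 0 := by simp [mulLeftAut]
@[simp] theorem mulLeftAut_one : mulLeftAut (of 1) = of 0 * of 1 := by simp [mulLeftAut]

/-- The group of automorphisms of `F_2` permuting the generators and their inverses. -/
def signedPerm : Subgroup (MulAut (FG 2)) := Subgroup.closure {swapAut, invAut}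

/-- The subgroup of `Aut F_2` generated by Nielsen transformations and inner automorphisms. -/
def nielsenSubgroup : Subgroup (MulAut (FG 2)) :=
  Subgroup.closure {swapAut, invAut, mulLeftAut} ⊔ MulAut.conj.range

theorem swapAut_mem : swapAut ∈ signedPerm := Subgroup.subset_closure (by simp)
theorem invAut_mem : invAut ∈ signedPerm := Subgroup.subset_closure (by simp)

theorem signedPerm_le : signedPerm ≤ nielsenSubgroup :=
  le_trans (Subgroup.closure_mono (by intro; simp; tauto)) le_sup_left

theorem mulLeftAut_mem : mulLeftAut ∈ nielsenSubgroup :=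
  Subgroup.mem_sup_left (Subgroup.subset_closure (by simp))

theorem conj_mem (g : FG 2) : MulAut.conj g ∈ nielsenSubgroup :=
  Subgroup.mem_sup_right ⟨g, rfl⟩

/-- `φ` lies outside the Nielsen subgroup, with images of the generators of least total length. -/
def IsMinimalAut (φ : MulAut (FG 2)) : Prop :=
  φ ∉ nielsenSubgroup ∧ ∀ ψ ∉ nielsenSubgroup,
    (φ (of 0)).norm + (φ (of 1)).norm ≤ (ψ (of 0)).norm + (ψ (of 1)).norm

/-- The pair `(a, b)` is the image of the standard basis under a minimal automorphism. -/
def IsMinimalPair (a b : FG 2) : Prop :=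
  ∃ φ, IsMinimalAut φ ∧ φ (of 0) = a ∧ φ (of 1) = b

theorem IsMinimalPair.symm {a b : FG 2} : IsMinimalPair a b → IsMinimalPair b a := by
  rintro ⟨φ, ⟨h1, h2⟩, rfl, rfl⟩
  refine ⟨φ * swapAut, ⟨?_, ?_⟩, by simp, by simp⟩
  · rwa [Subgroup.mul_mem_cancel_right _ (signedPerm_le swapAut_mem)]
  · intro ψ hψ
    have := h2 ψ hψ
    simpa [add_comm] using this

theorem IsMinimalPair.inv_right {a b : FG 2} : IsMinimalPair a b → IsMinimalPair a b⁻¹ := by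
  rintro ⟨φ, ⟨h1, h2⟩, rfl, rfl⟩
  refine ⟨φ * invAut, ⟨?_, ?_⟩, by simp, by simp⟩
  · rwa [Subgroup.mul_mem_cancel_right _ (signedPerm_le invAut_mem)]
  · intro ψ hψ
    have := h2 ψ hψ
    simpa [norm_inv_eq] using this

theorem IsMinimalPair.inv_left {a b : FG 2} (h : IsMinimalPair a b) : IsMinimalPair a⁻¹ b :=
  h.symm.inv_right.symm

theorem IsMinimalPair.norm_right_le {a b : FG 2} :
    IsMinimalPair a b → b.norm ≤ (a * b).norm := by
  rintro ⟨φ, ⟨h1, h2⟩, rfl, rfl⟩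
  have := h2 (φ * mulLeftAut) (by rwa [Subgroup.mul_mem_cancel_right _ mulLeftAut_mem])
  simpa using this

theorem IsMinimalPair.norm_left_le {a b : FG 2} (h : IsMinimalPair a b) :
    a.norm ≤ (a * b).norm := by
  have := h.inv_left.inv_right.symm.norm_right_le
  rwa [← mul_inv_rev, norm_inv_eq, norm_inv_eq] at this

theorem IsMinimalPair.left_ne_one {a b : FG 2} : IsMinimalPair a b → a ≠ 1 := by
  rintro ⟨φ, -, rfl, -⟩
  simp [of_ne_one]

theorem IsMinimalPair.two_mul_overlap_le {a b : FG 2} (h : IsMinimalPair a b) :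
    2 * overlap a⁻¹ b ≤ a.norm ∧ 2 * overlap a⁻¹ b ≤ b.norm := by
  have h1 := h.norm_left_le
  have h2 := h.norm_right_le
  have h3 := norm_mul_add a b
  omega

theorem IsMinimalPair.overlap_add_lt {a b : FG 2} (h : IsMinimalPair a b) :
    overlap b⁻¹ a + overlap a⁻¹ b < a.norm := by
  have h1 := h.two_mul_overlap_le
  have h2 := h.symm.two_mul_overlap_le
  by_contra! h3
  have ha : a.norm ≠ 0 := by rw [Ne, norm_eq_zero]; exact h.left_ne_one
  obtain ⟨s, l, r, hs1, hs2, hs3⟩ := exists_eq_append_of_commonPrefix b⁻¹.toWord a.toWord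
  obtain ⟨p, q, m, hp1, hp2, hp3⟩ := exists_eq_append_of_commonPrefix a⁻¹.toWord b.toWord
  have h4 : a.toWord = invRev q ++ invRev p := by
    rw [← invRev_append, ← hp2, toWord_inv, invRev_invRev]
  have h5 : b.toWord = invRev l ++ invRev s := by
    rw [← invRev_append, ← hs2, toWord_inv, invRev_invRev]
  change s.length = overlap b⁻¹ a at hs1
  change p.length = overlap a⁻¹ b at hp1
  have n1 : a.norm = s.length + r.length := by rw [norm, hs3, List.length_append]
  have n2 : a.norm = q.length + p.length := by
    rw [norm, h4, List.length_append, invRev_length, invRev_length]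
  have n3 : b.norm = l.length + s.length := by
    rw [norm, h5, List.length_append, invRev_length, invRev_length]
  have h6 : r = invRev p :=
    (List.append_inj (hs3.symm.trans h4) (by rw [invRev_length]; omega)).2
  obtain ⟨k, hk⟩ : p <+: invRev l :=
    List.prefix_of_prefix_length_le ⟨m, hp3.symm⟩ ⟨invRev s, h5.symm⟩
      (by rw [invRev_length]; omega)
  have n4 : l.length = p.length + k.length := by
    rw [← invRev_length (L₁ := l), ← hk, List.length_append]
  have ea : a = mk s * (mk p)⁻¹ := by
    rw [← mk_toWord (x := a), hs3, h6, ← mul_mk, ← inv_mk]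
  have eb : b = mk p * mk k * (mk s)⁻¹ := by
    rw [← mk_toWord (x := b), h5, ← hk, ← mul_mk, ← mul_mk, ← inv_mk]
  obtain ⟨φ, ⟨hφ1, hφ2⟩, e1, e2⟩ := h
  have := hφ2 (MulAut.conj (mk s)⁻¹ * (φ * mulLeftAut)) (by
    rwa [Subgroup.mul_mem_cancel_left _ (conj_mem _),
      Subgroup.mul_mem_cancel_right _ mulLeftAut_mem])
  simp only [MulAut.mul_apply, mulLeftAut_zero, mulLeftAut_one, _root_.map_mul, e1, e2] at this
  have e3 : MulAut.conj (mk s)⁻¹ a = (mk p)⁻¹ * mk s := by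
    rw [MulAut.conj_apply, ea]; group
  have e4 : (mk p)⁻¹ * mk s * MulAut.conj (mk s)⁻¹ b = mk k := by
    rw [MulAut.conj_apply, eb]; group
  rw [e3, e4] at this
  have b1 := norm_mul_le (mk p)⁻¹ (mk s)
  have b2 := norm_mk_le (L₁ := p)
  have b3 := norm_mk_le (L₁ := s)
  have b4 := norm_mk_le (L₁ := k)
  rw [norm_inv_eq] at b1
  omega

theorem mk_singleton_inv {α : Type*} (l : α × Bool) : (mk [l])⁻¹ = mk [(l.1, !l.2)] := by
  rw [inv_mk]; rfl

theorem IsMinimalAut.pair {φ : MulAut (FG 2)} (h : IsMinimalAut φ) {l l' : Fin 2 × Bool}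
    (hl : l.1 ≠ l'.1) : IsMinimalPair (φ (mk [l])) (φ (mk [l'])) := by
  have h0 : IsMinimalPair (φ (mk [(0, true)])) (φ (mk [(1, true)])) := ⟨φ, h, rfl, rfl⟩
  have e0 : mk [((0 : Fin 2), false)] = (mk [(0, true)])⁻¹ := by rw [mk_singleton_inv]; rfl
  have e1 : mk [((1 : Fin 2), false)] = (mk [(1, true)])⁻¹ := by rw [mk_singleton_inv]; rfl
  obtain ⟨i, b⟩ := l
  obtain ⟨i', b'⟩ := l'
  have h1 := h0.inv_left
  have h2 := h0.inv_right
  have h3 := h0.inv_left.inv_right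
  fin_cases i <;> fin_cases i' <;> first | (exact absurd rfl hl) | skip
  all_goals cases b <;> cases b' <;>
    simp only [e0, e1, _root_.map_inv, Fin.mk_one, Fin.zero_eta] <;>
    first | assumption | (apply IsMinimalPair.symm; assumption)

theorem mk_singleton_ne_one (l : Fin 2 × Bool) : mk [l] ≠ 1 := by
  rw [Ne, ← norm_eq_zero, norm_mk_of_isReduced (List.IsChain.singleton _)]
  simp

theorem IsMinimalAut.two_mul_overlap_le {φ : MulAut (FG 2)} (h : IsMinimalAut φ)
    {l l' : Fin 2 × Bool} (hl : l.1 = l'.1 → l.2 = l'.2) :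
    2 * overlap (φ (mk [l]))⁻¹ (φ (mk [l'])) ≤ (φ (mk [l])).norm ∧
      2 * overlap (φ (mk [l]))⁻¹ (φ (mk [l'])) ≤ (φ (mk [l'])).norm := by
  by_cases h1 : l.1 = l'.1
  · obtain rfl : l = l' := Prod.ext h1 (hl h1)
    have := two_mul_overlap_inv_lt (a := φ (mk [l])) (by simp [mk_singleton_ne_one])
    omega
  · exact (h.pair h1).two_mul_overlap_le

theorem IsMinimalAut.overlap_add_lt {φ : MulAut (FG 2)} (h : IsMinimalAut φ)
    {l₁ l₂ l₃ : Fin 2 × Bool} (h12 : l₁.1 = l₂.1 → l₁.2 = l₂.2) (h23 : l₂.1 = l₃.1 → l₂.2 = l₃.2) :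
    overlap (φ (mk [l₁]))⁻¹ (φ (mk [l₂])) + overlap (φ (mk [l₂]))⁻¹ (φ (mk [l₃])) <
      (φ (mk [l₂])).norm := by
  have a1 := h.two_mul_overlap_le h12
  have a2 := h.two_mul_overlap_le h23
  have a3 := two_mul_overlap_inv_lt (a := φ (mk [l₂])) (by simp [mk_singleton_ne_one])
  by_cases e1 : l₁.1 = l₂.1
  · obtain rfl : l₁ = l₂ := Prod.ext e1 (h12 e1)
    omega
  by_cases e2 : l₂.1 = l₃.1
  · obtain rfl : l₂ = l₃ := Prod.ext e2 (h23 e2)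
    omega
  have e3 : l₃.1 = l₁.1 := by omega
  by_cases e4 : l₃.2 = l₁.2
  · obtain rfl : l₃ = l₁ := Prod.ext e3 e4
    exact (h.pair e2).overlap_add_lt
  · have e5 : mk [l₃] = (mk [l₁])⁻¹ := by
      rw [mk_singleton_inv]
      congr 2
      ext
      · simp [e3]
      · cases h5 : l₁.2 <;> cases h6 : l₃.2 <;> simp_all
    have := overlap_ultrametric (φ (mk [l₂]))⁻¹ (φ (mk [l₃])) (φ (mk [l₂]))
    have hc := overlap_comm (φ (mk [l₁]))⁻¹ (φ (mk [l₂]))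
    rw [e5, _root_.map_inv] at this a2 ⊢
    omega

theorem IsMinimalAut.norm_le_and_overlap_eq {φ : MulAut (FG 2)} (h : IsMinimalAut φ)
    (l : Fin 2 × Bool) (w : List (Fin 2 × Bool)) (hw : IsReduced (l :: w)) :
    (φ (mk [l])).norm ≤ (φ (mk (l :: w))).norm ∧ (w ≠ [] → 2 ≤ (φ (mk (l :: w))).norm) ∧
      ∀ k, IsReduced (k :: l :: w) →
        overlap (φ (mk [k]))⁻¹ (φ (mk (l :: w))) = overlap (φ (mk [k]))⁻¹ (φ (mk [l])) := by
  induction w generalizing l with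
  | nil => simp
  | cons l' w ih =>
    have hl := (List.isChain_cons_cons.1 hw)
    obtain ⟨h1, -, h2⟩ := ih l' hl.2
    have e : φ (mk (l :: l' :: w)) = φ (mk [l]) * φ (mk (l' :: w)) := by
      rw [← _root_.map_mul, mul_mk, List.singleton_append]
    have h3 := norm_mul_add (φ (mk [l])) (φ (mk (l' :: w)))
    have h4 := norm_inv_mul_add (φ (mk [l]) * φ (mk (l' :: w))) (φ (mk [l]))
    rw [h2 l hw] at h3
    rw [show (φ (mk [l]) * φ (mk (l' :: w)))⁻¹ * φ (mk [l]) = (φ (mk (l' :: w)))⁻¹ by group,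
      norm_inv_eq] at h4
    change _ + 2 * overlap _ _ = _ at h4
    have h5 := h.two_mul_overlap_le hl.1
    have ne : ∀ k, (φ (mk [k])).norm ≠ 0 := by intro k; simp [norm_eq_zero, mk_singleton_ne_one]
    have n1 := ne l
    have n2 := ne l'
    rw [e]
    refine ⟨by omega, fun _ => by omega, fun k hk => ?_⟩
    have hk' := (List.isChain_cons_cons.1 hk).1
    have h6 := h.overlap_add_lt hk' hl.1
    have h7 := overlap_ultrametric (φ (mk [k]))⁻¹ (φ (mk [l]) * φ (mk (l' :: w))) (φ (mk [l]))
    have h8 := overlap_ultrametric (φ (mk [k]))⁻¹ (φ (mk [l])) (φ (mk [l]) * φ (mk (l' :: w)))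
    rw [overlap_comm (φ (mk [l])) (φ (mk [l]) * φ (mk (l' :: w)))] at h8
    omega

theorem mem_signedPerm_of_letters {φ : MulAut (FG 2)} {l l' : Fin 2 × Bool}
    (h0 : φ (of 0) = mk [l]) (h1 : φ (of 1) = mk [l']) : φ ∈ signedPerm := by
  have hne : l.1 ≠ l'.1 := by
    intro h
    rcases Bool.eq_or_eq_not l.2 l'.2 with h2 | h2
    · rw [Prod.ext h h2, ← h1] at h0
      exact absurd (of_injective (φ.injective h0)) (by decide)
    · have h3 : φ (of 0) = φ (of 1)⁻¹ := by
        rw [_root_.map_inv, h1, mk_singleton_inv, h0, ← h, ← h2]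
      have h4 := φ.injective h3
      exact absurd h4 (by decide)
  have hd : swapAut * invAut * swapAut ∈ signedPerm :=
    mul_mem (mul_mem swapAut_mem invAut_mem) swapAut_mem
  have t0 : ∀ i : Fin 2, mk [(i, true)] = of i := fun _ => rfl
  have e0 : ∀ i : Fin 2, mk [(i, false)] = (of i)⁻¹ := fun i => by
    rw [← t0, mk_singleton_inv]; rfl
  obtain ⟨i, b⟩ := l
  obtain ⟨i', b'⟩ := l'
  have key : ∀ ψ ∈ signedPerm, φ (of 0) = ψ (of 0) → φ (of 1) = ψ (of 1) → φ ∈ signedPerm :=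
    fun ψ hψ a b => by rwa [mulAut_ext a b]
  fin_cases i <;> fin_cases i' <;> first | (exact absurd rfl hne) | skip
  all_goals cases b <;> cases b'
  all_goals simp only [e0, t0, Fin.mk_one, Fin.zero_eta] at h0 h1
  · exact key _ (mul_mem hd invAut_mem) (by simp [h0]) (by simp [h1])
  · exact key _ hd (by simp [h0]) (by simp [h1])
  · exact key _ invAut_mem (by simp [h0]) (by simp [h1])
  · exact key _ (one_mem _) (by simp [h0]) (by simp [h1])
  · exact key _ (mul_mem (mul_mem hd invAut_mem) swapAut_mem) (by simp [h0]) (by simp [h1])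
  · exact key _ (mul_mem invAut_mem swapAut_mem) (by simp [h0]) (by simp [h1])
  · exact key _ (mul_mem hd swapAut_mem) (by simp [h0]) (by simp [h1])
  · exact key _ swapAut_mem (by simp [h0]) (by simp [h1])

theorem not_isMinimalAut (φ : MulAut (FG 2)) : ¬ IsMinimalAut φ := by
  intro h
  have key : ∀ i : Fin 2, ∃ l, φ⁻¹ (of i) = mk [l] := by
    intro i
    have e : φ (mk (φ⁻¹ (of i)).toWord) = of i := by rw [mk_toWord, MulAut.apply_inv_self]
    have hr := isReduced_toWord (x := φ⁻¹ (of i))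
    have hm := mk_toWord (x := φ⁻¹ (of i))
    cases hw : (φ⁻¹ (of i)).toWord with
    | nil =>
      rw [hw] at e
      simp [← one_eq_mk, of_ne_one, eq_comm] at e
    | cons l w =>
      rw [hw] at e hr hm
      have := (h.norm_le_and_overlap_eq l w hr).2.1
      rw [e, norm_of] at this
      obtain rfl : w = [] := by by_contra h; have := this h; omega
      exact ⟨l, hm.symm⟩
  obtain ⟨l, hl⟩ := key 0
  obtain ⟨l', hl'⟩ := key 1
  exact h.1 ((inv_mem_iff).1 (signedPerm_le (mem_signedPerm_of_letters hl hl')))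

theorem nielsenSubgroup_eq_top : nielsenSubgroup = ⊤ := by
  rw [eq_top_iff]
  intro φ _
  by_contra hφ
  obtain ⟨ψ, h1, h2⟩ := WellFounded.has_min
    (InvImage.wf (fun φ : MulAut (FG 2) => (φ (of 0)).norm + (φ (of 1)).norm) wellFounded_lt)
    {ψ | ψ ∉ nielsenSubgroup} ⟨φ, hφ⟩
  exact not_isMinimalAut ψ ⟨h1, fun χ hχ => not_lt.1 (h2 χ hχ)⟩

section Decomposition

variable {G : Type*} [Group G] {w d t : G}

theorem exists_commute_mul_of_mem_closure (hw : w * w = 1) (hd : d * d = 1)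
    (hν : Commute (w * d * (w * d)) t) {e : G} (he : e ∈ Subgroup.closure {w, d}) :
    ∃ z ∈ Subgroup.closure {w, d}, Commute z t ∧ Commute z (w * t * w) ∧
      ∃ f ∈ ({1, d, w, d * w} : Set G), e = z * f := by
  have hwi : w⁻¹ = w := inv_eq_of_mul_eq_one_left hw
  have hdi : d⁻¹ = d := inv_eq_of_mul_eq_one_left hd
  have mw : w ∈ Subgroup.closure {w, d} := Subgroup.subset_closure (by simp)
  have md : d ∈ Subgroup.closure {w, d} := Subgroup.subset_closure (by simp)
  set ν := w * d * (w * d) with hνdef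
  have mν : ν ∈ Subgroup.closure {w, d} := mul_mem (mul_mem mw md) (mul_mem mw md)
  have hν' : Commute ν (w * t * w) := by
    have e1 : ν * w = w * ν⁻¹ := by
      rw [hνdef]; simp only [mul_inv_rev, hwi, hdi, mul_assoc]
    have e2 : ν⁻¹ * w = w * ν := by
      rw [hνdef]; simp only [mul_inv_rev, hwi, hdi, mul_assoc]
      rw [hw, mul_one, ← mul_assoc w w, hw, one_mul]
    have e3 : ν⁻¹ * t = t * ν⁻¹ := hν.inv_left
    calc ν * (w * t * w) = (ν * w) * t * w := by group
      _ = w * (ν⁻¹ * t) * w := by rw [e1]; group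
      _ = w * t * (ν⁻¹ * w) := by rw [e3]; group
      _ = w * t * w * ν := by rw [e2]; group
  have step : ∀ y ∈ ({w, d} : Set G), ∀ f ∈ ({1, d, w, d * w} : Set G),
      ∃ z ∈ ({1, ν, ν⁻¹} : Set G), ∃ f' ∈ ({1, d, w, d * w} : Set G), f * y = z * f' := by
    intro y hy f hf
    simp only [Set.mem_insert_iff, Set.mem_singleton_iff] at hy hf
    rcases hy with hy | hy
    · refine ⟨1, by simp, f * y, ?_, by simp⟩
      rcases hf with hf | hf | hf | hf <;> simp [hf, hy, hw, mul_assoc]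
    · rcases hf with hf | hf | hf | hf
      · exact ⟨1, by simp, d, by simp, by simp [hf, hy]⟩
      · exact ⟨1, by simp, 1, by simp, by simp [hf, hy, hd]⟩
      · refine ⟨ν, by simp, d * w, by simp, ?_⟩
        rw [hνdef, hf, hy]
        calc w * d = w * d * (w * ((d * d) * w)) := by rw [hd, one_mul, hw, mul_one]
          _ = _ := by group
      · refine ⟨ν⁻¹, by simp, w, by simp, ?_⟩
        rw [hνdef, hf, hy]
        simp only [mul_inv_rev, hwi, hdi, mul_assoc, hw, mul_one]
  have extend : ∀ y ∈ ({w, d} : Set G), ∀ e, (∃ z ∈ Subgroup.closure {w, d}, Commute z t ∧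
      Commute z (w * t * w) ∧ ∃ f ∈ ({1, d, w, d * w} : Set G), e = z * f) →
      ∃ z ∈ Subgroup.closure {w, d}, Commute z t ∧ Commute z (w * t * w) ∧
      ∃ f ∈ ({1, d, w, d * w} : Set G), e * y = z * f := by
    rintro y hy e ⟨z, hz, h1, h2, f, hf, rfl⟩
    obtain ⟨z', hz', f', hf', h⟩ := step y hy f hf
    refine ⟨z * z', mul_mem hz ?_, h1.mul_left ?_, h2.mul_left ?_, f', hf', by
      rw [mul_assoc, h, mul_assoc]⟩ <;>
    rcases hz' with rfl | rfl | rfl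
    exacts [one_mem _, mν, inv_mem mν, Commute.one_left _, hν, hν.inv_left, Commute.one_left _,
      hν', hν'.inv_left]
  induction he using Subgroup.closure_induction_right with
  | one => exact ⟨1, one_mem _, by simp, by simp, 1, by simp, by simp⟩
  | mul_right e he y hy ih => exact extend y hy e ih
  | mul_inv_cancel e he y hy ih =>
    have : y⁻¹ = y := by rcases hy with rfl | rfl <;> assumption
    rw [this]
    exact extend y hy e ih

/-- A rewriting normal form: every element of the group generated by involutions `w`, `d` and by
`t` is a word in `w`, `d`, followed by a monoid word in `t` and `w t w`, followed by one of
`1`, `d`, `w`, `d w`. -/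
theorem exists_eq_mul_mul (hw : w * w = 1) (hd : d * d = 1) (hdt : d * t * d = t⁻¹)
    (hwt : w * t * w * t⁻¹ = t * w * d) (hν : Commute (w * d * (w * d)) t) {g : G}
    (hg : g ∈ Subgroup.closure {w, d, t}) :
    ∃ s ∈ Subgroup.closure {w, d}, ∃ p ∈ Submonoid.closure {t, w * t * w},
      ∃ f ∈ ({1, d, w, d * w} : Set G), g = s * p * f := by
  have hwi : w⁻¹ = w := inv_eq_of_mul_eq_one_left hw
  have hdi : d⁻¹ = d := inv_eq_of_mul_eq_one_left hd
  have mw : w ∈ Subgroup.closure {w, d} := Subgroup.subset_closure (by simp)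
  have md : d ∈ Subgroup.closure {w, d} := Subgroup.subset_closure (by simp)
  have mt : t ∈ Submonoid.closure {t, w * t * w} := Submonoid.subset_closure (by simp)
  have mσ : w * t * w ∈ Submonoid.closure {t, w * t * w} := Submonoid.subset_closure (by simp)
  set σ := w * t * w with hσ
  let N : Set G := {g | ∃ s ∈ Subgroup.closure {w, d}, ∃ p ∈ Submonoid.closure {t, σ},
      ∃ f ∈ ({1, d, w, d * w} : Set G), g = s * p * f}
  have hdw : ∀ a, d * (d * a) = a := fun a => by rw [← mul_assoc, hd, one_mul]
  have hww : ∀ a, w * (w * a) = a := fun a => by rw [← mul_assoc, hw, one_mul]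
  have mem_N : ∀ s ∈ Subgroup.closure {w, d}, ∀ p ∈ Submonoid.closure {t, σ},
      ∀ e ∈ Subgroup.closure {w, d}, s * p * e ∈ N := by
    intro s hs p hp e he
    obtain ⟨z, hz, h1, h2, f, hf, rfl⟩ := exists_commute_mul_of_mem_closure hw hd hν he
    refine ⟨s * z, mul_mem hs hz, p, hp, f, hf, ?_⟩
    have : Commute z p := by
      induction hp using Submonoid.closure_induction with
      | mem x hx => rcases hx with rfl | rfl <;> assumption
      | one => exact Commute.one_right _
      | mul x y _ _ hx hy => exact hx.mul_right hy
    rw [mul_assoc s z, this.eq]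
    simp only [mul_assoc]
  have cases_p : ∀ p ∈ Submonoid.closure {t, σ}, p = 1 ∨
      ∃ q ∈ Submonoid.closure {t, σ}, p = q * t ∨ p = q * σ := by
    intro p hp
    induction hp using Submonoid.closure_induction_right with
    | one => exact Or.inl rfl
    | mul_right q hq y hy _ =>
      refine Or.inr ⟨q, hq, ?_⟩
      rcases hy with rfl | rfl <;> simp
  have hσi : σ⁻¹ = w * (d * (t * (d * w))) := by
    rw [hσ, mul_inv_rev, mul_inv_rev, ← hdt, hwi]
    simp only [mul_assoc]
  have hdσ : d * σ = σ⁻¹ * d := by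
    have e1 : w * d * (w * d) * t = t * (w * d * (w * d)) := hν
    calc d * σ = d * w * (t * (w * d * (w * d))) * (d * w * (d * w)) * w := by
          simp only [hσ, mul_assoc, hdw, hww]
      _ = σ⁻¹ * d := by
          rw [← e1, hσi]
          simp only [mul_assoc, hdw, hww, hw, mul_one]
  have hwt' : t * σ⁻¹ = σ * d * w := by
    calc t * σ⁻¹ = w * (σ * t⁻¹) * w := by
          rw [hσ]
          simp only [mul_inv_rev, hwi, mul_assoc, hww]
      _ = σ * d * w := by
          rw [hwt, hσ]
          simp only [mul_assoc]
  have mul_t_inv : ∀ s ∈ Subgroup.closure {w, d}, ∀ p ∈ Submonoid.closure {t, σ},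
      ∀ e ∈ Subgroup.closure {w, d}, s * p * t⁻¹ * e ∈ N := by
    intro s hs p hp e he
    rcases cases_p p hp with rfl | ⟨q, hq, rfl | rfl⟩
    · have := mem_N _ (mul_mem hs md) t mt _ (mul_mem md he)
      rw [← hdt]; simpa only [mul_assoc, one_mul, mul_one] using this
    · have := mem_N _ hs q hq _ he
      simpa only [mul_assoc, mul_inv_cancel_left] using this
    · have := mem_N _ hs _ (mul_mem hq mt) _ (mul_mem (mul_mem mw md) he)
      rw [mul_assoc s, mul_assoc q, hwt]
      simpa only [mul_assoc] using this
  have mul_σ_inv : ∀ s ∈ Subgroup.closure {w, d}, ∀ p ∈ Submonoid.closure {t, σ},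
      ∀ e ∈ Subgroup.closure {w, d}, s * p * σ⁻¹ * e ∈ N := by
    intro s hs p hp e he
    rcases cases_p p hp with rfl | ⟨q, hq, rfl | rfl⟩
    · have := mem_N _ (mul_mem hs (mul_mem mw md)) t mt _ (mul_mem (mul_mem md mw) he)
      rw [hσi]; simpa only [mul_assoc, one_mul, mul_one] using this
    · have := mem_N _ hs _ (mul_mem hq mσ) _ (mul_mem (mul_mem md mw) he)
      rw [mul_assoc s, mul_assoc q, hwt']
      simpa only [mul_assoc] using this
    · have := mem_N _ hs q hq _ he
      simpa only [mul_assoc, mul_inv_cancel_left] using this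
  have step : ∀ g ∈ N, ∀ y ∈ ({w, d, t} : Set G), g * y ∈ N := by
    rintro _ ⟨s, hs, p, hp, f, hf, rfl⟩ y hy
    have hf' : f ∈ Subgroup.closure {w, d} := by
      rcases hf with rfl | rfl | rfl | rfl
      exacts [one_mem _, md, mw, mul_mem md mw]
    rcases hy with hy | hy | hy
    · rw [hy, mul_assoc]
      exact mem_N s hs p hp _ (mul_mem hf' mw)
    · rw [hy, mul_assoc]
      exact mem_N s hs p hp _ (mul_mem hf' md)
    · have hy : y = t := hy
      rw [hy]
      rcases hf with hf | hf | hf | hf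
      · have := mem_N s hs _ (mul_mem hp mt) 1 (one_mem _)
        rw [hf]; simpa only [mul_assoc, mul_one] using this
      · have := mul_t_inv s hs p hp d md
        rw [hf]; rw [← hdt] at this
        simpa only [mul_assoc, hd, mul_one] using this
      · have := mem_N s hs _ (mul_mem hp mσ) w mw
        rw [hf]
        simpa only [hσ, mul_assoc, hw, mul_one] using this
      · have := mul_σ_inv s hs p hp _ (mul_mem md mw)
        rw [mul_assoc _ σ⁻¹, ← mul_assoc σ⁻¹, ← hdσ] at this
        rw [hf]
        have h2 : σ * w = w * t := by rw [hσ, mul_assoc, hw, mul_one]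
        rw [mul_assoc d, h2] at this
        simpa only [mul_assoc] using this
  induction hg using Subgroup.closure_induction_right with
  | one => exact ⟨1, one_mem _, 1, one_mem _, 1, by simp, by simp⟩
  | mul_right e he y hy ih => exact step _ ih y hy
  | mul_inv_cancel e he y hy ih =>
    rcases hy with hy | hy | hy
    · rw [hy, hwi]; exact step _ ih w (by simp)
    · rw [hy, hdi]; exact step _ ih d (by simp)
    · have hy : y = t := hy
      rw [hy, ← hdt, ← mul_assoc, ← mul_assoc]
      exact step _ (step _ (step _ ih d (by simp)) t (by simp)) d (by simp)

end Decomposition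

instance : (MulAut.conj (G := FG 2)).range.Normal where
  conj_mem := by
    rintro _ ⟨g, rfl⟩ φ
    refine ⟨φ g, ?_⟩
    ext a
    simp [MulAut.conj_apply]

/-- The automorphism `x ↦ y x`, `y ↦ y` of `F_2`. -/
def mulRightAut : MulAut (FG 2) := swapAut * mulLeftAut * swapAut

@[simp] theorem mulRightAut_zero : mulRightAut (of 0) = of 1 * of 0 := by simp [mulRightAut]
@[simp] theorem mulRightAut_one : mulRightAut (of 1) = of 1 := by simp [mulRightAut]

theorem mk_eq_mk_of_conj {φ ψ : MulAut (FG 2)} (g : FG 2) (h : φ = MulAut.conj g * ψ) :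
    (QuotientGroup.mk φ : MulAut (FG 2) ⧸ (MulAut.conj (G := FG 2)).range) =
      QuotientGroup.mk ψ := by
  have h1 : MulAut.conj g ∈ (MulAut.conj (G := FG 2)).range := ⟨g, rfl⟩
  rw [h, QuotientGroup.mk_mul, (QuotientGroup.eq_one_iff (MulAut.conj g)).2 h1, one_mul]

/-- Every automorphism of `F_2` is, up to an inner automorphism, a signed permutation after a
positive automorphism after one of `1`, `invAut`, `swapAut`, `invAut * swapAut`. -/
theorem exists_mulAut_eq (φ : MulAut (FG 2)) :
    ∃ g, ∃ s ∈ signedPerm, ∃ p ∈ Submonoid.closure {mulLeftAut, mulRightAut},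
      ∃ f ∈ ({1, invAut, swapAut, invAut * swapAut} : Set (MulAut (FG 2))),
        φ = MulAut.conj g * (s * p * f) := by
  let Q := QuotientGroup.mk' (MulAut.conj (G := FG 2)).range
  have hmem : Q φ ∈ Subgroup.closure {Q swapAut, Q invAut, Q mulLeftAut} := by
    have h1 : φ ∈ nielsenSubgroup := by rw [nielsenSubgroup_eq_top]; trivial
    have h2 := Subgroup.mem_map_of_mem Q h1
    rw [nielsenSubgroup, Subgroup.map_sup, MonoidHom.map_closure, Subgroup.map_eq_bot_iff _|>.2,
      sup_bot_eq] at h2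
    · simpa [Set.image_insert_eq] using h2
    · rw [QuotientGroup.ker_mk']
  obtain ⟨s', hs, p', hp, f', hf, h⟩ := exists_eq_mul_mul
    (w := Q swapAut) (d := Q invAut) (t := Q mulLeftAut)
    (by rw [← _root_.map_mul, ← _root_.map_one Q]; congr 1; apply mulAut_ext <;> simp)
    (by rw [← _root_.map_mul, ← _root_.map_one Q]; congr 1; apply mulAut_ext <;> simp)
    (by
      rw [eq_comm, ← _root_.map_mul, ← _root_.map_mul, ← _root_.map_inv]
      refine mk_eq_mk_of_conj (of 0)⁻¹ ?_
      rw [inv_eq_iff_mul_eq_one]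
      apply mulAut_ext <;> simp [mul_assoc])
    (by
      rw [mul_inv_eq_iff_eq_mul]
      simp only [← _root_.map_mul]
      refine mk_eq_mk_of_conj (of 0)⁻¹ ?_
      apply mulAut_ext <;> simp [mul_assoc])
    (by
      rw [commute_iff_eq]
      simp only [← _root_.map_mul]
      refine mk_eq_mk_of_conj (of 0)⁻¹ ?_
      apply mulAut_ext <;> simp [mul_assoc])
    hmem
  have hs' : s' ∈ signedPerm.map Q := by
    rw [signedPerm, MonoidHom.map_closure]
    simpa [Set.image_insert_eq] using hs
  have hp' : p' ∈ (Submonoid.closure {mulLeftAut, mulRightAut}).map Q := by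
    rw [MonoidHom.map_mclosure]
    simpa [Set.image_insert_eq, mulRightAut] using hp
  have hf' : f' ∈ Q '' {1, invAut, swapAut, invAut * swapAut} := by
    simpa [Set.image_insert_eq] using hf
  clear hs hp hf
  obtain ⟨s, hs, rfl⟩ := hs'
  obtain ⟨p, hp, rfl⟩ := hp'
  obtain ⟨f, hf, rfl⟩ := hf'
  rw [← _root_.map_mul, ← _root_.map_mul] at h
  have h3 : φ * (s * p * f)⁻¹ ∈ (MulAut.conj (G := FG 2)).range := by
    rw [← QuotientGroup.ker_mk' (MulAut.conj (G := FG 2)).range, MonoidHom.mem_ker,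
      _root_.map_mul, _root_.map_inv]
    exact mul_inv_eq_one.2 h
  obtain ⟨g, hg⟩ := h3
  exact ⟨g, s, hs, p, hp, f, hf, by rw [hg, inv_mul_cancel_right]⟩

/-- The reduced word of the power `x ^ a` of the first generator. -/
def xpow (a : ℤ) : List (Fin 2 × Bool) := List.replicate a.natAbs (0, decide (0 ≤ a))

theorem mk_replicate (n : ℕ) (l : Fin 2 × Bool) : mk (List.replicate n l) = mk [l] ^ n := by
  induction n with
  | zero => rfl
  | succ n ih => rw [List.replicate_succ, ← List.singleton_append, ← mul_mk, ih, pow_succ']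

theorem mk_xpow (a : ℤ) : mk (xpow a) = (of 0 : FG 2) ^ a := by
  rw [xpow, mk_replicate]
  obtain h | h := le_or_gt 0 a
  · obtain ⟨n, rfl⟩ := Int.eq_ofNat_of_zero_le h
    simp [of]
  · obtain ⟨n, hn⟩ := Int.eq_ofNat_of_zero_le (a := -a) (by omega)
    obtain rfl : a = -n := by omega
    have : decide ((0 : ℤ) ≤ -n) = false := by simp; omega
    rw [this, Int.natAbs_neg, Int.natAbs_natCast, zpow_neg, zpow_natCast, ← inv_pow, of,
      mk_singleton_inv]
    rfl

theorem xpow_succ_append (k : ℕ) (l : List (Fin 2 × Bool)) :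
    xpow (k + 1) ++ l = xpow k ++ (0, true) :: l := by
  have h1 : ((k : ℤ) + 1).natAbs = k + 1 := by omega
  have h2 : decide ((0 : ℤ) ≤ k + 1) = true := by simp; omega
  simp [xpow, h1, h2, List.replicate_succ']

/-- The exponents `a` of the first generator allowed between consecutive occurrences of the second
generator with signs `e` and `e'`. -/
def Spacing (m : ℕ) (e : Bool) (a : ℤ) (e' : Bool) : Prop :=
  match e, e' with
  | true, true => m ≤ a
  | false, false => -(m + 1 : ℤ) ≤ a
  | _, _ => 1 ≤ a

/-- `SpacedPath m e w e'`: the word `w` is a product of blocks `x ^ a y ^ ±1` in which every two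
consecutive occurrences of `y ^ ±1` satisfy `Spacing m`, starting after a letter `y ^ e` and ending
with a letter `y ^ e'`. -/
inductive SpacedPath (m : ℕ) : Bool → List (Fin 2 × Bool) → Bool → Prop
  | nil (e : Bool) : SpacedPath m e [] e
  | cons {e e' e'' : Bool} {a : ℤ} {w : List (Fin 2 × Bool)} :
      Spacing m e a e' → SpacedPath m e' w e'' → SpacedPath m e (xpow a ++ (1, e') :: w) e''

theorem mk_block (a : ℤ) (e : Bool) (w : List (Fin 2 × Bool)) :
    mk (xpow a ++ (1, e) :: w) = of 0 ^ a * (mk [(1, e)] * mk w) := by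
  rw [← mk_xpow, mul_mk, mul_mk, List.singleton_append]

/-- The correction at the ends of a spaced path under `x ↦ x`, `y ↦ x y`. -/
def tailCorrection (e : Bool) : FG 2 := if e then 1 else (of 0)⁻¹

theorem SpacedPath.shift {m : ℕ} {e e' : Bool} {w : List (Fin 2 × Bool)}
    (h : SpacedPath m e w e') : ∃ w', SpacedPath (m + 1) e w' e' ∧
      mulLeftAut (mk w) = (tailCorrection e)⁻¹ * mk w' * tailCorrection e' := by
  induction h with
  | nil e => exact ⟨[], .nil e, by simp [← one_eq_mk]⟩
  | @cons e e' e'' a w hs _ ih =>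
    obtain ⟨w', hw, h⟩ := ih
    refine ⟨_, .cons (a := a + (if e' then 1 else 0) - (if e then 0 else 1)) ?_ hw, ?_⟩
    · cases e <;> cases e' <;> simp only [Spacing] at hs ⊢ <;> push_cast <;> simp <;> omega
    · have h1 : mk [((1 : Fin 2), true)] = of 1 := rfl
      have h2 : mk [((1 : Fin 2), false)] = (of 1)⁻¹ := by rw [← h1, mk_singleton_inv]; rfl
      rw [mk_block, mk_block, _root_.map_mul, _root_.map_mul, h, map_zpow, mulLeftAut_zero]
      generalize tailCorrection e'' = D
      cases e <;> cases e' <;>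
        simp only [tailCorrection, h1, h2, _root_.map_inv, mulLeftAut_one, if_true, if_false,
          Bool.false_eq_true] <;> group

theorem SpacedPath.getLast? {m : ℕ} {e e' : Bool} {w : List (Fin 2 × Bool)}
    (h : SpacedPath m e w e') : ((1, e) :: w).getLast? = some (1, e') := by
  induction h with
  | nil e => rfl
  | @cons e e' e'' a w hs _ ih =>
    rw [← List.cons_append, List.getLast?_append, ih]
    rfl

/-- The automorphism `x ↦ y⁻¹`, `y ↦ x⁻¹` of `F_2`. -/
def flipAut : MulAut (FG 2) := swapAut * invAut * swapAut * invAut * swapAut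

@[simp] theorem flipAut_zero : flipAut (of 0) = (of 1)⁻¹ := by simp [flipAut]
@[simp] theorem flipAut_one : flipAut (of 1) = (of 0)⁻¹ := by simp [flipAut]

/-- The action of `flipAut` on letters. -/
def flipLetter (l : Fin 2 × Bool) : Fin 2 × Bool := (1 - l.1, !l.2)

theorem flipAut_mk (w : List (Fin 2 × Bool)) : flipAut (mk w) = mk (w.map flipLetter) := by
  induction w with
  | nil => simp [← one_eq_mk]
  | cons l w ih =>
    rw [← List.singleton_append, ← mul_mk, _root_.map_mul, ih, List.map_append, ← mul_mk]
    congr 1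
    have t0 : ∀ i : Fin 2, mk [(i, true)] = of i := fun _ => rfl
    have e0 : ∀ i : Fin 2, mk [(i, false)] = (of i)⁻¹ := fun i => by
      rw [← t0, mk_singleton_inv]; rfl
    obtain ⟨i, b⟩ := l
    fin_cases i <;> cases b <;> simp [flipLetter, e0, t0]

theorem flipAut_flipAut (g : FG 2) : flipAut (flipAut g) = g := by
  have : flipAut * flipAut = 1 := by apply mulAut_ext <;> simp
  rw [← MulAut.mul_apply, this, MulAut.one_apply]

/-- Adjacency of letters in a reduced word in which `x⁻¹` has only `y⁻¹` as neighbours. -/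
def IsolatedAdj (a b : Fin 2 × Bool) : Prop :=
  (a.1 = b.1 → a.2 = b.2) ∧ (a = (0, false) → b = (1, false)) ∧ (b = (0, false) → a = (1, false))

theorem SpacedPath.isChain_flip {m : ℕ} (hm : 1 ≤ m) {e e' : Bool} {w : List (Fin 2 × Bool)}
    (h : SpacedPath m e w e') : (((1, e) :: w).map flipLetter).IsChain IsolatedAdj := by
  rw [List.isChain_map]
  induction h with
  | nil e => simp
  | @cons e e' e'' a w hs _ ih =>
    have key : a.natAbs = 0 ∧ e = false ∧ e' = false ∨ (a.natAbs ≠ 0 ∧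
        ((e = true ∨ e' = true) → 0 ≤ a)) := by
      cases e <;> cases e' <;> simp [Spacing] at hs ⊢ <;> omega
    rw [xpow]
    generalize a.natAbs = n at key ⊢
    have hb : (e = true ∨ e' = true) → n ≠ 0 → decide (0 ≤ a) = true := by
      intro h1 h2
      simp only [decide_eq_true_eq]
      tauto
    generalize decide (0 ≤ a) = b at hb
    rcases n with _ | n
    · refine List.isChain_cons_cons.2 ⟨?_, ih⟩
      obtain ⟨-, rfl, rfl⟩ : True ∧ e = false ∧ e' = false := by simpa using key
      simp [IsolatedAdj, flipLetter]
    · have main : ∀ k, ((0, b) :: (List.replicate k (0, b) ++ (1, e') :: w)).IsChain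
          fun u v => IsolatedAdj (flipLetter u) (flipLetter v) := by
        intro k
        induction k with
        | zero =>
          refine List.isChain_cons_cons.2 ⟨?_, ih⟩
          cases b <;> cases e' <;> simp_all [IsolatedAdj, flipLetter]
        | succ k ihk =>
          refine List.isChain_cons_cons.2 ⟨?_, ihk⟩
          simp [IsolatedAdj, flipLetter]
      refine List.isChain_cons_cons.2 ⟨?_, main n⟩
      cases b <;> cases e <;> simp_all [IsolatedAdj, flipLetter]

theorem exists_spacedPath_of_isChain (w : List (Fin 2 × Bool)) :
    (∀ e, ((1, e) :: w).IsChain IsolatedAdj → (∀ l ∈ ((1, e) :: w).getLast?, l.1 = 1) →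
      ∃ e', SpacedPath 0 e w e') ∧
    (∀ e, ∀ k : ℕ, ((0, true) :: w).IsChain IsolatedAdj →
      (∀ l ∈ ((0, true) :: w).getLast?, l.1 = 1) → ∃ e', SpacedPath 0 e (xpow (k + 1) ++ w) e') ∧
    (((0, false) :: w).IsChain IsolatedAdj → (∀ l ∈ ((0, false) :: w).getLast?, l.1 = 1) →
      ∃ e', SpacedPath 0 false ((0, false) :: w) e') := by
  induction w with
  | nil =>
    refine ⟨fun e _ _ => ⟨e, .nil e⟩, ?_, ?_⟩ <;> simp
  | cons l w ih =>
    obtain ⟨ih1, ih2, ih3⟩ := ih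
    simp only [List.isChain_cons_cons, List.getLast?_cons_cons]
    refine ⟨?_, ?_, ?_⟩
    · rintro e ⟨⟨h1, h2, h3⟩, hc⟩ hl
      obtain ⟨i, b⟩ := l
      fin_cases i
      · cases b
        · obtain rfl : e = false := by simpa using h3
          exact ih3 hc hl
        · simpa [xpow] using ih2 e 0 hc hl
      · obtain rfl : e = b := by simpa using h1
        obtain ⟨e', he⟩ := ih1 e hc hl
        refine ⟨e', .cons (a := 0) ?_ he⟩
        cases e <;> simp [Spacing]
    · rintro e k ⟨⟨h1, h2, h3⟩, hc⟩ hl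
      obtain ⟨i, b⟩ := l
      fin_cases i
      · obtain rfl : true = b := by simpa using h1
        have := ih2 e (k + 1) hc hl
        rw [xpow_succ_append] at this
        exact_mod_cast this
      · obtain ⟨e', he⟩ := ih1 b hc hl
        refine ⟨e', .cons ?_ he⟩
        cases e <;> cases b <;> simp [Spacing] <;> omega
    · rintro ⟨⟨h1, h2, h3⟩, hc⟩ hl
      obtain rfl := h2 rfl
      obtain ⟨e', he⟩ := ih1 false hc hl
      exact ⟨e', .cons (a := -1) (by simp [Spacing]) he⟩

theorem exists_spacedPath_rotate {e b : Bool} {A B : List (Fin 2 × Bool)}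
    (h : ((0, e) :: (A ++ (1, b) :: B)).IsChain IsolatedAdj)
    (hlast : ((1, b) :: B).getLast? = some (0, e)) :
    SpacedPath 0 b (B ++ A ++ [(1, b)]) b := by
  obtain ⟨B', hB⟩ : ∃ B', (1, b) :: B = B' ++ [(0, e)] :=
    ⟨_, (List.dropLast_append_getLast? _ hlast).symm⟩
  have h1 : ((0, e) :: A ++ [(1, b)]).IsChain IsolatedAdj := by
    refine List.IsChain.prefix h ⟨B, by simp⟩
  have h2 : (B' ++ [(0, e)]).IsChain IsolatedAdj := by
    rw [← hB]
    exact List.IsChain.suffix h ⟨(0, e) :: A, by simp⟩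
  have h3 : ((1, b) :: (B ++ A ++ [(1, b)])).IsChain IsolatedAdj := by
    have := List.IsChain.append_overlap (l₂ := [(0, e)]) (l₃ := A ++ [(1, b)]) h2
      (by simpa using h1) (by simp)
    rw [← hB] at this
    simpa using this
  obtain ⟨e', he⟩ := (exists_spacedPath_of_isChain _).1 b h3 (by
    rw [← List.cons_append, List.getLast?_append]; simp)
  have := he.getLast?
  rw [← List.cons_append, List.getLast?_append] at this
  obtain rfl : b = e' := by simpa using this
  exact he

/-- Elements conjugate to a closed spaced path or to its image under `flipAut`. -/
def IsTame (g : FG 2) : Prop :=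
  ∃ h : FG 2, ∃ m : ℕ, 1 ≤ m ∧ ∃ e w, SpacedPath m e w e ∧
    (g = h * mk w * h⁻¹ ∨ g = h * flipAut (mk w) * h⁻¹)

theorem SpacedPath.isTame {m : ℕ} (hm : 1 ≤ m) {e : Bool} {w : List (Fin 2 × Bool)}
    (h : SpacedPath m e w e) : IsTame (mk w) :=
  ⟨1, m, hm, e, w, h, Or.inl (by simp)⟩

theorem IsTame.conj {g : FG 2} (hg : IsTame g) (k : FG 2) : IsTame (k * g * k⁻¹) := by
  obtain ⟨h, m, hm, e, w, hw, rfl | rfl⟩ := hg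
  · exact ⟨k * h, m, hm, e, w, hw, Or.inl (by group)⟩
  · exact ⟨k * h, m, hm, e, w, hw, Or.inr (by group)⟩

theorem IsTame.flip {g : FG 2} (hg : IsTame g) : IsTame (flipAut g) := by
  obtain ⟨h, m, hm, e, w, hw, rfl | rfl⟩ := hg
  · exact ⟨flipAut h, m, hm, e, w, hw, Or.inr (by simp)⟩
  · exact ⟨flipAut h, m, hm, e, w, hw, Or.inl (by simp [flipAut_flipAut])⟩

theorem SpacedPath.isTame_mulLeftAut {m : ℕ} {e : Bool} {w : List (Fin 2 × Bool)}
    (h : SpacedPath m e w e) : IsTame (mulLeftAut (mk w)) := by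
  obtain ⟨w', hw', h'⟩ := h.shift
  have := (hw'.isTame (by omega)).conj (tailCorrection e)⁻¹
  rwa [inv_inv, ← h'] at this

theorem mulLeftAut_mk_of_forall {w : List (Fin 2 × Bool)} (h : ∀ l ∈ w, l.1 = 0) :
    mulLeftAut (mk w) = mk w := by
  induction w with
  | nil => simp [← one_eq_mk]
  | cons l w ih =>
    rw [← List.singleton_append, ← mul_mk, _root_.map_mul, ih fun l hl => h l (by simp [hl])]
    congr 1
    obtain ⟨i, b⟩ := l
    obtain rfl : i = 0 := h (i, b) (by simp)
    have t0 : mk [((0 : Fin 2), true)] = of 0 := rfl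
    have e0 : mk [((0 : Fin 2), false)] = (of 0)⁻¹ := by rw [← t0, mk_singleton_inv]; rfl
    cases b <;> simp [e0, t0]

theorem SpacedPath.isTame_mulLeftAut_flip {m : ℕ} (hm : 1 ≤ m) {e : Bool}
    {w : List (Fin 2 × Bool)} (h : SpacedPath m e w e) :
    IsTame (mulLeftAut (flipAut (mk w))) := by
  have hc := h.isChain_flip hm
  have hl := h.getLast?
  rw [List.map_cons] at hc
  rw [flipAut_mk]
  by_cases hall : ∀ l ∈ w.map flipLetter, l.1 = 0
  · rw [mulLeftAut_mk_of_forall hall, ← flipAut_mk]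
    exact (h.isTame hm).flip
  · push Not at hall
    obtain ⟨⟨i, b⟩, hmem, hi⟩ := hall
    obtain rfl : i = 1 := by
      have : i ≠ 0 := hi
      omega
    obtain ⟨A, B, hAB⟩ := List.append_of_mem hmem
    have hl' : ((1, b) :: B).getLast? = some (0, !e) := by
      have : (((1, e) :: w).map flipLetter).getLast? = some (flipLetter (1, e)) := by
        rw [List.getLast?_map, hl]; rfl
      rw [List.map_cons, hAB, ← List.cons_append, List.getLast?_append] at this
      cases hB : ((1, b) :: B).getLast? with
      | none => simp at hB
      | some v =>
        rw [hB] at this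
        simpa [flipLetter] using this
    rw [hAB] at hc ⊢
    have := (exists_spacedPath_rotate hc hl').isTame_mulLeftAut.conj
      (mulLeftAut (mk (A ++ [(1, b)])))
    rw [← _root_.map_inv, ← _root_.map_mul, ← _root_.map_mul] at this
    convert this using 2
    rw [eq_mul_inv_iff_mul_eq, mul_mk, mul_mk]
    simp

theorem IsTame.mulLeftAut {g : FG 2} (hg : IsTame g) : IsTame (mulLeftAut g) := by
  obtain ⟨h, m, hm, e, w, hw, rfl | rfl⟩ := hg
  · simpa using hw.isTame_mulLeftAut.conj (FreeGroup.mulLeftAut h)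
  · simpa using (hw.isTame_mulLeftAut_flip hm).conj (FreeGroup.mulLeftAut h)

theorem IsTame.mulRightAut {g : FG 2} (hg : IsTame g) : IsTame (mulRightAut g) := by
  have h : FreeGroup.mulRightAut =
      MulAut.conj (of 1) * (flipAut * (FreeGroup.mulLeftAut * flipAut)) := by
    apply mulAut_ext <;> simp [mul_assoc]
  rw [h]
  simpa using hg.flip.mulLeftAut.flip.conj (of 1)

theorem IsTame.of_mem_closure {g : FG 2} (hg : IsTame g) {p : MulAut (FG 2)}
    (hp : p ∈ Submonoid.closure {FreeGroup.mulLeftAut, FreeGroup.mulRightAut}) :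
    IsTame (p g) := by
  induction hp using Submonoid.closure_induction generalizing g with
  | mem x hx =>
    rcases hx with rfl | rfl
    exacts [hg.mulLeftAut, hg.mulRightAut]
  | one => exact hg
  | mul x y _ _ hx hy => exact hx (hy hg)

/-- The monoid of positive elements of `F_2`. -/
def positiveMonoid : Submonoid (FG 2) := Submonoid.closure {of 0, of 1}

theorem mem_positiveMonoid_of_positive {v : FG 2} (hv : Positive v) : v ∈ positiveMonoid := by
  have key : ∀ w : List (Fin 2 × Bool), (∀ l ∈ w, l.2 = true) → mk w ∈ positiveMonoid := by
    intro w hw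
    induction w with
    | nil => exact one_mem _
    | cons l w ih =>
      rw [← List.singleton_append, ← mul_mk]
      refine mul_mem (Submonoid.subset_closure ?_) (ih fun l hl => hw l (by simp [hl]))
      obtain ⟨i, b⟩ := l
      obtain rfl : b = true := hw (i, b) (by simp)
      fin_cases i
      · exact Or.inl rfl
      · exact Or.inr rfl
  rw [← mk_toWord (x := v)]
  exact key _ hv

theorem map_mem_positiveMonoid {φ : MulAut (FG 2)} (h0 : φ (of 0) ∈ positiveMonoid)
    (h1 : φ (of 1) ∈ positiveMonoid) {v : FG 2} (hv : v ∈ positiveMonoid) :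
    φ v ∈ positiveMonoid := by
  induction hv using Submonoid.closure_induction with
  | mem x hx => rcases hx with rfl | rfl <;> assumption
  | one => simp
  | mul x y _ _ hx hy => rw [_root_.map_mul]; exact mul_mem hx hy

theorem of_zero_mem : of 0 ∈ positiveMonoid := Submonoid.subset_closure (by simp)
theorem of_one_mem : of 1 ∈ positiveMonoid := Submonoid.subset_closure (by simp)

theorem map_mem_positiveMonoid_of_mem_closure {p : MulAut (FG 2)}
    (hp : p ∈ Submonoid.closure {mulLeftAut, mulRightAut}) {v : FG 2} (hv : v ∈ positiveMonoid) :
    p v ∈ positiveMonoid := by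
  induction hp using Submonoid.closure_induction generalizing v with
  | mem x hx =>
    rcases hx with rfl | rfl <;> refine map_mem_positiveMonoid ?_ ?_ hv <;>
      simp only [mulLeftAut_zero, mulLeftAut_one, mulRightAut_zero, mulRightAut_one] <;>
      first | exact of_zero_mem | exact of_one_mem | exact mul_mem of_zero_mem of_one_mem |
        exact mul_mem of_one_mem of_zero_mem
  | one => exact hv
  | mul x y _ _ hx hy => exact hx (hy hv)

theorem spacedPath_one_of_alternating (k : ℕ) (l : List (Fin 2)) :
    SpacedPath 1 false (xpow k ++ (l.map (fun i => (i, decide (i = 0))) ++ [(1, false)])) false := by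
  induction l generalizing k with
  | nil => exact .cons (by simp [Spacing]) (.nil _)
  | cons i l ih =>
    fin_cases i
    · have := ih (k + 1)
      push_cast at this
      rw [xpow_succ_append] at this
      exact this
    · refine .cons (by simp [Spacing]) (ih 0)

theorem isTame_invAut_of_mem_positiveMonoid {v : FG 2} (hv : v ∈ positiveMonoid) :
    IsTame (invAut v) := by
  obtain ⟨l, hl⟩ : ∃ l : List (Fin 2), invAut v = mk (l.map fun i => (i, decide (i = 0))) := by
    have t0 : mk [((0 : Fin 2), true)] = of 0 := rfl
    have e1 : mk [((1 : Fin 2), false)] = (of 1)⁻¹ := by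
      rw [show of 1 = mk [((1 : Fin 2), true)] from rfl, mk_singleton_inv]; rfl
    induction hv using Submonoid.closure_induction with
    | mem x hx =>
      rcases hx with rfl | rfl
      · exact ⟨[0], by simp [t0]⟩
      · exact ⟨[1], by simp [e1]⟩
    | one => exact ⟨[], by rw [_root_.map_one]; rfl⟩
    | mul x y _ _ hx hy =>
      obtain ⟨l, hl⟩ := hx
      obtain ⟨l', hl'⟩ := hy
      exact ⟨l ++ l', by simp [hl, hl', mul_mk]⟩
  rw [hl]
  by_cases h1 : 1 ∈ l
  · obtain ⟨A, B, rfl⟩ := List.append_of_mem h1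
    have := ((spacedPath_one_of_alternating 0 (B ++ A)).isTame le_rfl).conj
      (mk ((A ++ [1]).map fun i => (i, decide (i = 0))))
    convert this using 1
    rw [eq_mul_inv_iff_mul_eq]
    simp [xpow, mul_mk]
  · have : SpacedPath 1 false (l.map fun i => (1, false)) false := by
      clear hl
      induction l with
      | nil => exact .nil _
      | cons i l ih =>
        exact .cons (a := 0) (by simp [Spacing]) (ih fun h => h1 (List.mem_cons_of_mem _ h))
    have := (this.isTame le_rfl).flip
    rw [flipAut_mk] at this
    convert this using 2
    rw [List.map_map]
    refine List.map_congr_left fun i hi => ?_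
    have : i ≠ 1 := fun h => h1 (h ▸ hi)
    obtain rfl : i = 0 := by omega
    rfl

/-- A potentially positive element is, up to a signed permutation of the generators, conjugate to
a closed spaced path. -/
theorem exists_spacedPath_of_potentiallyPositive {u : FG 2}
    (hu : ∃ α : FG 2 ≃* FG 2, Positive (α u)) :
    ∃ s ∈ signedPerm, ∃ h : FG 2, ∃ m : ℕ, 1 ≤ m ∧ ∃ e w, SpacedPath m e w e ∧
      u = s (h * mk w * h⁻¹) := by
  suffices ∃ s ∈ signedPerm, ∃ g, IsTame g ∧ u = s g by
    obtain ⟨s, hs, _, ⟨h, m, hm, e, w, hw, rfl | rfl⟩, rfl⟩ := this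
    · exact ⟨s, hs, h, m, hm, e, w, hw, rfl⟩
    · refine ⟨s * flipAut, mul_mem hs ?_, flipAut h, m, hm, e, w, hw, ?_⟩
      · exact mul_mem (mul_mem (mul_mem (mul_mem swapAut_mem invAut_mem) swapAut_mem) invAut_mem)
          swapAut_mem
      · simp [flipAut_flipAut]
  obtain ⟨α, hα⟩ := hu
  have hv := mem_positiveMonoid_of_positive hα
  obtain ⟨g, s, hs, p, hp, f, hf, h⟩ := exists_mulAut_eq (α⁻¹ : MulAut (FG 2))
  have hu : u = (α⁻¹ : MulAut (FG 2)) (α u) := (MulAut.inv_apply_self _ α u).symm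
  have hsw : swapAut (α u) ∈ positiveMonoid :=
    map_mem_positiveMonoid (by simpa using of_one_mem) (by simpa using of_zero_mem) hv
  have hpos : ∀ v ∈ positiveMonoid, IsTame (invAut (p v)) := fun v hv =>
    isTame_invAut_of_mem_positiveMonoid (map_mem_positiveMonoid_of_mem_closure hp hv)
  have hneg : ∀ v ∈ positiveMonoid, IsTame (p (invAut v)) := fun v hv =>
    (isTame_invAut_of_mem_positiveMonoid hv).of_mem_closure hp
  have hii : ∀ g, invAut (invAut g) = g := fun g => by
    have : invAut * invAut = 1 := by apply mulAut_ext <;> simp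
    rw [← MulAut.mul_apply, this, MulAut.one_apply]
  obtain ⟨s', hs', g', hg', h'⟩ : ∃ s' ∈ signedPerm, ∃ g', IsTame g' ∧ p (f (α u)) = s' g' := by
    rcases hf with rfl | rfl | rfl | rfl
    · exact ⟨invAut, invAut_mem, _, hpos _ hv, (hii _).symm⟩
    · exact ⟨1, one_mem _, _, hneg _ hv, rfl⟩
    · exact ⟨invAut, invAut_mem, _, hpos _ hsw, (hii _).symm⟩
    · exact ⟨1, one_mem _, _, hneg _ hsw, rfl⟩
  refine ⟨s * s', mul_mem hs hs', _, hg'.conj ((s * s')⁻¹ g), ?_⟩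
  rw [hu, h]
  simp only [MulAut.mul_apply, MulAut.conj_apply, _root_.map_mul, _root_.map_inv, ← h']
  simp

/-- States of the automaton reading spaced paths: the last letter read, together with the number
`k` of further letters `x` needed before `y` is allowed, or of further letters `x⁻¹` allowed. -/
inductive PathState
  | y
  | yInv
  | x (k : ℕ)
  | xInv (k : ℕ)
  deriving DecidableEq

namespace PathState

/-- The transition function of the automaton reading spaced paths of parameter `m + 1`. -/
def step (m : ℕ) : PathState → Fin 2 × Bool → Option PathState
  | y, (0, true) => some (x m)
  | yInv, (1, false) => some yInv
  | yInv, (0, true) => some (x 0)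
  | yInv, (0, false) => some (xInv (m + 1))
  | x k, (0, true) => some (x (k - 1))
  | x 0, (1, true) => some y
  | x _, (1, false) => some yInv
  | xInv (k + 1), (0, false) => some (xInv k)
  | xInv _, (1, false) => some yInv
  | _, _ => none

/-- The state reached after reading a word. -/
def run (m : ℕ) : PathState → List (Fin 2 × Bool) → Option PathState
  | s, [] => some s
  | s, l :: w => (step m s l).bind fun s' => run m s' w

theorem run_append (m : ℕ) (s : PathState) (w w' : List (Fin 2 × Bool)) :
    run m s (w ++ w') = (run m s w).bind fun s' => run m s' w' := by
  induction w generalizing s with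
  | nil => rfl
  | cons l w ih =>
    simp only [List.cons_append, run, Option.bind_assoc]
    congr 1
    funext s'
    exact ih s'

theorem run_replicate_x (m k n : ℕ) (w : List (Fin 2 × Bool)) :
    run m (x k) (List.replicate n (0, true) ++ w) = run m (x (k - n)) w := by
  induction n generalizing k with
  | zero => rfl
  | succ n ih =>
    rw [List.replicate_succ, List.cons_append]
    simp only [run, step, Option.bind_some]
    rw [ih]
    congr 2
    omega

theorem run_replicate_xInv (m k n : ℕ) (w : List (Fin 2 × Bool)) :
    run m (xInv (k + n)) (List.replicate n (0, false) ++ w) = run m (xInv k) w := by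
  induction n generalizing k with
  | zero => rfl
  | succ n ih =>
    rw [List.replicate_succ, List.cons_append, ← add_assoc]
    simp only [run, step, Option.bind_some]
    rw [ih]

/-- The state after reading a letter `y ^ ±1`. -/
def ofSign (e : Bool) : PathState := if e then y else yInv

theorem _root_.FreeGroup.SpacedPath.run_eq {m : ℕ} {e e' : Bool} {w : List (Fin 2 × Bool)}
    (h : SpacedPath (m + 1) e w e') : run m (ofSign e) w = some (ofSign e') := by
  induction h with
  | nil e => rfl
  | @cons e e' e'' a w hs _ ih =>
    rw [← ih]
    obtain ha | ha := lt_or_ge 0 a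
    · obtain ⟨n, rfl⟩ : ∃ n : ℕ, a = n + 1 := ⟨(a - 1).toNat, by omega⟩
      have h1 : xpow (n + 1) = (0, true) :: List.replicate n (0, true) := by
        have h1 : ((n : ℤ) + 1).natAbs = n + 1 := by omega
        have h2 : decide ((0 : ℤ) ≤ n + 1) = true := by simp; omega
        rw [xpow, h1, h2, List.replicate_succ]
      rw [h1, List.cons_append]
      cases e <;> cases e' <;>
        simp only [ofSign, run, step, Option.bind_some, run_replicate_x, if_true, if_false,
          Bool.false_eq_true, Nat.zero_sub]
      have : m - n = 0 := by simp [Spacing] at hs; omega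
      simp [this]
    · obtain ⟨rfl, rfl⟩ : e = false ∧ e' = false := by
        cases e <;> cases e' <;> simp [Spacing] at hs ⊢ <;> omega
      obtain ⟨n, rfl⟩ : ∃ n : ℕ, a = -n := ⟨(-a).toNat, by omega⟩
      rcases n with _ | n
      · simp [xpow, ofSign, run, step]
      · have h1 : xpow (-(n + 1 : ℕ)) = (0, false) :: List.replicate n (0, false) := by
          have h1 : (-((n + 1 : ℕ) : ℤ)).natAbs = n + 1 := by omega
          have h2 : decide ((0 : ℤ) ≤ -((n + 1 : ℕ) : ℤ)) = false := by simp; omega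
          rw [xpow, h1, h2, List.replicate_succ]
        obtain ⟨k, hk⟩ : ∃ k, m + 1 = k + n := by
          simp [Spacing] at hs
          exact ⟨m + 1 - n, by omega⟩
        rw [h1, List.cons_append]
        simp only [ofSign, run, step, Option.bind_some, if_false, Bool.false_eq_true, hk,
          run_replicate_xInv]

/-- The states of the automaton of parameter `m + 1` which can be reached from `y ^ ±1`. -/
def reachable (m : ℕ) : Finset PathState :=
  {y, yInv} ∪ ((Finset.range (m + 1)).image x ∪ (Finset.range (m + 2)).image xInv)

theorem card_reachable_le (m : ℕ) : (reachable m).card ≤ 2 * m + 5 := by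
  refine (Finset.card_union_le _ _).trans ?_
  have h1 := Finset.card_union_le ((Finset.range (m + 1)).image x)
    ((Finset.range (m + 2)).image xInv)
  have h2 := Finset.card_image_le (s := Finset.range (m + 1)) (f := x)
  have h3 := Finset.card_image_le (s := Finset.range (m + 2)) (f := xInv)
  have h4 := Finset.card_le_two (a := y) (b := yInv)
  simp only [Finset.card_range] at h2 h3
  omega

theorem mem_reachable_of_step {m : ℕ} {s s' : PathState} {l : Fin 2 × Bool}
    (hs : s ∈ reachable m) (h : step m s l = some s') : s' ∈ reachable m := by
  revert hs
  unfold step at h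
  split at h <;> simp only [Option.some.injEq, reduceCtorEq] at h <;> subst h <;>
    simp [reachable] <;> omega

/-- The letter recorded by a state. -/
def letter : PathState → Fin 2 × Bool
  | y => (1, true)
  | yInv => (1, false)
  | x _ => (0, true)
  | xInv _ => (0, false)

theorem letter_of_step {m : ℕ} {s s' : PathState} {l : Fin 2 × Bool}
    (h : step m s l = some s') : letter s' = l ∧ ((letter s).1 = l.1 → (letter s).2 = l.2) := by
  unfold step at h
  split at h <;> simp only [Option.some.injEq, reduceCtorEq] at h <;> subst h <;>
    simp [letter]

theorem isReduced_of_run {m : ℕ} {s s' : PathState} {w : List (Fin 2 × Bool)}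
    (h : run m s w = some s') : IsReduced (letter s :: w) := by
  induction w generalizing s with
  | nil => exact List.isChain_singleton _
  | cons l w ih =>
    rw [run, Option.bind_eq_some_iff] at h
    obtain ⟨t, h1, h2⟩ := h
    obtain ⟨h3, h4⟩ := letter_of_step h1
    have := ih h2
    rw [h3] at this
    exact List.isChain_cons_cons.2 ⟨h4, this⟩

/-- `w` labels a loop in the reachable part of the automaton. -/
def IsLoop (m : ℕ) (w : List (Fin 2 × Bool)) : Prop :=
  ∃ s ∈ reachable m, run m s w = some s

theorem IsLoop.rotate {m : ℕ} {l : Fin 2 × Bool} {w : List (Fin 2 × Bool)}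
    (h : IsLoop m (l :: w)) : IsLoop m (w ++ [l]) := by
  obtain ⟨s, hs, h⟩ := h
  rw [run, Option.bind_eq_some_iff] at h
  obtain ⟨t, h1, h2⟩ := h
  refine ⟨t, mem_reachable_of_step hs h1, ?_⟩
  rw [run_append, h2]
  simp [run, h1]

theorem mem_reachable_of_run {m : ℕ} {s s' : PathState} {w : List (Fin 2 × Bool)}
    (hs : s ∈ reachable m) (h : run m s w = some s') : s' ∈ reachable m := by
  induction w generalizing s with
  | nil =>
    obtain rfl : s = s' := by simpa [run] using h
    exact hs
  | cons l w ih =>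
    rw [run, Option.bind_eq_some_iff] at h
    obtain ⟨t, h1, h2⟩ := h
    exact ih (mem_reachable_of_step hs h1) h2

theorem IsLoop.rotate_symm {m : ℕ} {l : Fin 2 × Bool} {w : List (Fin 2 × Bool)}
    (h : IsLoop m (w ++ [l])) : IsLoop m (l :: w) := by
  obtain ⟨s, hs, h⟩ := h
  rw [run_append, Option.bind_eq_some_iff] at h
  obtain ⟨t, h1, h2⟩ := h
  refine ⟨t, mem_reachable_of_run hs h1, ?_⟩
  have h3 : step m t l = some s := by simpa [run, Option.bind_eq_some_iff] using h2
  simp [run, h3, h1]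

theorem IsLoop.isReduced_append_self {m : ℕ} {w : List (Fin 2 × Bool)}
    (h : IsLoop m w) : IsReduced (w ++ w) := by
  obtain ⟨s, hs, h⟩ := h
  have : run m s (w ++ w) = some s := by rw [run_append, h]; exact h
  exact (isReduced_of_run this).of_cons

theorem IsLoop.exists_isReduced_conj {m : ℕ} {k c : List (Fin 2 × Bool)} (hk : IsReduced k)
    (hc : IsLoop m c) : ∃ k' c', IsLoop m c' ∧ c'.length = c.length ∧
      IsReduced (k' ++ c' ++ invRev k') ∧
        mk (k ++ c ++ invRev k) = mk (k' ++ c' ++ invRev k') := by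
  induction k using List.reverseRecOn generalizing c with
  | nil =>
    refine ⟨[], c, hc, rfl, ?_, rfl⟩
    simpa using hc.isReduced_append_self.infix ⟨[], c, rfl⟩
  | append_singleton k l ih =>
    have hk0 : IsReduced k := hk.infix ⟨[], [l], rfl⟩
    have hinv : mk [l] * mk [(l.1, !l.2)] = 1 := by rw [← mk_singleton_inv, mul_inv_cancel]
    have hinv' : mk [(l.1, !l.2)] * mk [l] = 1 := by rw [← mk_singleton_inv, inv_mul_cancel]
    have hrev : invRev (k ++ [l]) = (l.1, !l.2) :: invRev k := by simp [invRev]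
    have hcc := hc.isReduced_append_self
    cases c with
    | nil =>
      refine ⟨[], [], ⟨PathState.y, by simp [reachable], rfl⟩, rfl, List.isChain_nil, ?_⟩
      rw [List.append_nil, ← mul_mk, ← inv_mk, mul_inv_cancel]
      rfl
    | cons a c =>
      by_cases h1 : a = (l.1, !l.2)
      · obtain ⟨k', c', h2, h3, h4, h5⟩ := ih hk0 hc.rotate
        refine ⟨k', c', h2, by simpa using h3, h4, ?_⟩
        rw [← h5, hrev, h1]
        have e1 : mk (k ++ [l] ++ (l.1, !l.2) :: c ++ (l.1, !l.2) :: invRev k) =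
            mk k * (mk [l] * mk [(l.1, !l.2)]) * (mk c * mk [(l.1, !l.2)] * mk (invRev k)) := by
          simp only [mul_mk]
          simp
        rw [e1, hinv, mul_one]
        simp only [mul_mk]
        simp
      · obtain ⟨c₀, b, hb⟩ : ∃ c₀ b, a :: c = c₀ ++ [b] :=
          ⟨_, _, (List.dropLast_append_getLast (List.cons_ne_nil a c)).symm⟩
        by_cases h2 : b = l
        · subst h2
          rw [hb] at hc
          obtain ⟨k', c', h2, h3, h4, h5⟩ := ih hk0 hc.rotate_symm
          refine ⟨k', c', h2, by rw [h3, hb]; simp, h4, ?_⟩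
          rw [← h5, hrev, hb]
          have e1 : mk (k ++ [b] ++ (c₀ ++ [b]) ++ (b.1, !b.2) :: invRev k) =
              mk k * mk [b] * mk c₀ * (mk [b] * mk [(b.1, !b.2)]) * mk (invRev k) := by
            simp only [mul_mk]
            simp
          rw [e1, hinv, mul_one]
          simp only [mul_mk]
          simp
        · refine ⟨k ++ [l], a :: c, hc, rfl, ?_, rfl⟩
          have hne : ∀ u v : Fin 2 × Bool, u ≠ (v.1, !v.2) → v.1 = u.1 → v.2 = u.2 := by
            decide
          have hne' : ∀ u v : Fin 2 × Bool, u ≠ v → u.1 = v.1 → u.2 = !v.2 := by decide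
          refine List.IsChain.append (List.IsChain.append hk ?_ ?_) (isReduced_invRev hk) ?_
          · exact hcc.infix ⟨[], a :: c, rfl⟩
          · intro u hu v hv
            simp only [List.getLast?_concat, List.head?_cons, Option.mem_some_iff] at hu hv
            subst hu hv
            exact hne a l h1
          · intro u hu v hv
            rw [hb, ← List.append_assoc] at hu
            rw [hrev] at hv
            simp only [List.getLast?_concat, List.head?_cons, Option.mem_some_iff] at hu hv
            subst hu hv
            exact hne' b l h2

/-- The words of length `n` which can be read starting from the state `s`. -/
def accepted (m : ℕ) : ℕ → PathState → Finset (List (Fin 2 × Bool))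
  | 0, _ => {[]}
  | n + 1, s => Finset.univ.biUnion fun l =>
      match step m s l with
      | some s' => (accepted m n s').image (l :: ·)
      | none => ∅

theorem mem_accepted_of_run {m : ℕ} {s s' : PathState} {w : List (Fin 2 × Bool)}
    (h : run m s w = some s') : w ∈ accepted m w.length s := by
  induction w generalizing s with
  | nil => simp [accepted]
  | cons l w ih =>
    rw [run, Option.bind_eq_some_iff] at h
    obtain ⟨t, h1, h2⟩ := h
    rw [List.length_cons, accepted, Finset.mem_biUnion]
    refine ⟨l, Finset.mem_univ _, ?_⟩
    rw [h1]
    exact Finset.mem_image_of_mem _ (ih h2)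

/-- A positive function `v` on states with `∑ v (s') ≤ lam * v s`, the sum being over all
transitions `s → s'`. -/
noncomputable def weight (lam : ℝ) (m : ℕ) : PathState → ℝ
  | yInv => 1
  | xInv k => (1 - lam⁻¹ ^ (k + 1)) / (lam - 1)
  | x k => (1 - lam⁻¹ ^ k) / (lam - 1) +
      lam⁻¹ ^ k * (lam - 1 - (1 - lam⁻¹ ^ (m + 2)) / (lam - 1))
  | y => lam⁻¹ * ((1 - lam⁻¹ ^ m) / (lam - 1) +
      lam⁻¹ ^ m * (lam - 1 - (1 - lam⁻¹ ^ (m + 2)) / (lam - 1)))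

theorem weight_x_zero_le {lam : ℝ} (h1 : 5 / 2 ≤ lam) (h2 : lam ≤ 63 / 25)
    (hroot : lam ^ 4 - 3 * lam ^ 3 + lam ^ 2 + lam - 1 = 0) (m : ℕ) :
    weight lam m (x 0) + weight lam m y + 1 ≤ lam * weight lam m (x 0) := by
  have hq0 : 0 < lam⁻¹ := by positivity
  have hq1 : lam⁻¹ ≤ 2 / 5 := by
    rw [inv_le_comm₀ (by positivity) (by norm_num)]; linarith
  have hq2 : 25 / 63 ≤ lam⁻¹ := by
    rw [le_inv_comm₀ (by norm_num) (by positivity)]; linarith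
  have hr0 : 0 < lam⁻¹ ^ m := by positivity
  have hr1 : lam⁻¹ ^ m ≤ 1 := pow_le_one₀ hq0.le (by linarith)
  have hql : lam⁻¹ * lam = 1 := inv_mul_cancel₀ (by positivity)
  have hi0 : 0 < (lam - 1)⁻¹ := by rw [inv_pos]; linarith
  have hi1 : (lam - 1)⁻¹ ≤ 2 / 3 := by
    rw [inv_le_comm₀ (by linarith) (by norm_num)]; linarith
  have hi2 : 25 / 38 ≤ (lam - 1)⁻¹ := by
    rw [le_inv_comm₀ (by norm_num) (by linarith)]; linarith
  have him : (lam - 1)⁻¹ * (lam - 1) = 1 := inv_mul_cancel₀ (by linarith)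
  have hpol : (lam - 1) ^ 2 - 2 - lam⁻¹ * (lam - 1)⁻¹ = 0 := by
    have h3 : lam ≠ 0 := by positivity
    have h4 : lam - 1 ≠ 0 := by linarith
    field_simp
    linear_combination hroot
  simp only [weight, pow_add, div_eq_mul_inv, pow_zero]
  generalize lam⁻¹ ^ m = r at *
  generalize lam⁻¹ = q at *
  generalize (lam - 1)⁻¹ = i at *
  have key : 0 ≤ q * r * (q + 2 * i - (lam - 1) - q ^ 2 * r * i) := by
    have h5 : q ^ 2 * r * i ≤ (2 / 5) ^ 2 * 1 * (2 / 3) := by gcongr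
    have : 0 ≤ q + 2 * i - (lam - 1) - q ^ 2 * r * i := by linarith
    positivity
  linear_combination key - hpol + (1 - q ^ 2 * r) * him

theorem sum_weight_le {lam : ℝ} (h1 : 5 / 2 ≤ lam) (h2 : lam ≤ 63 / 25)
    (hroot : lam ^ 4 - 3 * lam ^ 3 + lam ^ 2 + lam - 1 = 0) (m : ℕ) (s : PathState) :
    ∑ l, (match step m s l with | some s' => weight lam m s' | none => 0) ≤
      lam * weight lam m s := by
  have hql : lam⁻¹ * lam = 1 := inv_mul_cancel₀ (by positivity)
  have him : (lam - 1)⁻¹ * (lam - 1) = 1 := inv_mul_cancel₀ (by linarith)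
  have h0 := weight_x_zero_le h1 h2 hroot m
  rw [Fintype.sum_prod_type]
  simp only [Fin.sum_univ_two, Fintype.sum_bool]
  rcases s with _ | _ | (_ | k) | (_ | k)
  · simp only [step]
    simp only [weight]
    refine le_of_eq ?_
    rw [← mul_assoc, mul_comm lam, hql]
    ring
  · simp only [step, weight, div_eq_mul_inv]
    refine le_of_eq ?_
    ring
  · simp only [step]
    rw [show weight lam m yInv = 1 from rfl]
    linarith
  · simp only [step, weight, div_eq_mul_inv, Nat.add_sub_cancel]
    refine le_of_eq ?_
    simp only [pow_add, pow_one]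
    generalize lam - 1 - (1 - lam⁻¹ ^ m * lam⁻¹ ^ 2) * (lam - 1)⁻¹ = X
    generalize (lam - 1)⁻¹ = i at *
    linear_combination -him + (i - X) * lam⁻¹ ^ k * hql
  · simp only [step, weight, div_eq_mul_inv]
    refine le_of_eq ?_
    simp only [pow_add, pow_one, pow_zero]
    generalize (lam - 1)⁻¹ = i at *
    linear_combination -him + i * hql
  · simp only [step, weight, div_eq_mul_inv]
    refine le_of_eq ?_
    simp only [pow_add, pow_one]
    generalize (lam - 1)⁻¹ = i at *
    linear_combination -him + i * lam⁻¹ ^ k * lam⁻¹ * hql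

theorem weight_mem {lam : ℝ} (h1 : 5 / 2 ≤ lam) (h2 : lam ≤ 63 / 25) (m : ℕ) (s : PathState) :
    1 / 6 ≤ weight lam m s ∧ weight lam m s ≤ 4 := by
  have hq0 : 0 < lam⁻¹ := by positivity
  have hq1 : lam⁻¹ ≤ 2 / 5 := by
    rw [inv_le_comm₀ (by positivity) (by norm_num)]; linarith
  have hq2 : 25 / 63 ≤ lam⁻¹ := by
    rw [le_inv_comm₀ (by norm_num) (by positivity)]; linarith
  have hi0 : 0 < (lam - 1)⁻¹ := by rw [inv_pos]; linarith
  have hi1 : (lam - 1)⁻¹ ≤ 2 / 3 := by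
    rw [inv_le_comm₀ (by linarith) (by norm_num)]; linarith
  have hi2 : 25 / 38 ≤ (lam - 1)⁻¹ := by
    rw [le_inv_comm₀ (by norm_num) (by linarith)]; linarith
  have hp0 : ∀ k, 0 < lam⁻¹ ^ k := fun k => by positivity
  have hp1 : ∀ k, lam⁻¹ ^ k ≤ 1 := fun k => pow_le_one₀ hq0.le (by linarith)
  have hX : 1 / 2 ≤ lam - 1 - (1 - lam⁻¹ ^ (m + 2)) / (lam - 1) ∧
      lam - 1 - (1 - lam⁻¹ ^ (m + 2)) / (lam - 1) ≤ 2 := by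
    have h3 : 0 ≤ (1 - lam⁻¹ ^ (m + 2)) * (lam - 1)⁻¹ :=
      mul_nonneg (by linarith [hp1 (m + 2)]) hi0.le
    have h4 : lam⁻¹ ^ (m + 2) * (lam - 1)⁻¹ ≥ 0 := mul_nonneg (hp0 (m + 2)).le hi0.le
    simp only [div_eq_mul_inv]
    constructor <;> linarith
  have hx : ∀ k, 1 / 2 ≤ weight lam m (x k) ∧ weight lam m (x k) ≤ 2 := by
    intro k
    simp only [weight]
    generalize lam - 1 - (1 - lam⁻¹ ^ (m + 2)) / (lam - 1) = X at hX
    simp only [div_eq_mul_inv]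
    constructor <;> nlinarith [hp0 k, hp1 k]
  rcases s with _ | _ | k | k
  · have : weight lam m y = lam⁻¹ * weight lam m (x m) := rfl
    have h3 := hx m
    rw [this]
    constructor <;> nlinarith
  · norm_num [weight]
  · have := hx k
    constructor <;> linarith
  · simp only [weight, div_eq_mul_inv]
    have h3 : lam⁻¹ ^ (k + 1) ≤ 2 / 5 := by
      rw [pow_succ]; nlinarith [hp0 k, hp1 k]
    have := hp0 (k + 1)
    constructor <;> nlinarith

theorem card_accepted_mul_le {lam : ℝ} (h1 : 5 / 2 ≤ lam) (h2 : lam ≤ 63 / 25)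
    (hroot : lam ^ 4 - 3 * lam ^ 3 + lam ^ 2 + lam - 1 = 0) (m n : ℕ) (s : PathState) :
    ((accepted m n s).card : ℝ) * (1 / 6) ≤ lam ^ n * weight lam m s := by
  induction n generalizing s with
  | zero => simpa [accepted] using (weight_mem h1 h2 m s).1
  | succ n ih =>
    rw [accepted]
    refine (mul_le_mul_of_nonneg_right (Nat.cast_le.2 Finset.card_biUnion_le)
      (by norm_num)).trans ?_
    rw [Nat.cast_sum, Finset.sum_mul, pow_succ, mul_assoc]
    refine le_trans ?_ (mul_le_mul_of_nonneg_left (sum_weight_le h1 h2 hroot m s) (by positivity))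
    rw [Finset.mul_sum]
    refine Finset.sum_le_sum fun l _ => ?_
    cases step m s l with
    | none => simp
    | some t =>
      exact (mul_le_mul_of_nonneg_right (Nat.cast_le.2 Finset.card_image_le)
        (by norm_num)).trans (ih t)

theorem card_accepted_le {lam : ℝ} (h1 : 5 / 2 ≤ lam) (h2 : lam ≤ 63 / 25)
    (hroot : lam ^ 4 - 3 * lam ^ 3 + lam ^ 2 + lam - 1 = 0) (m n : ℕ) (s : PathState) :
    ((accepted m n s).card : ℝ) ≤ 24 * lam ^ n := by
  have h3 := card_accepted_mul_le h1 h2 hroot m n s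
  have h4 := (weight_mem h1 h2 m s).2
  have h5 : 0 < lam ^ n := by positivity
  nlinarith

end PathState

theorem SpacedPath.mono {m N : ℕ} {e e' : Bool} {w : List (Fin 2 × Bool)}
    (h : SpacedPath m e w e') (hw : w.length ≤ N) (hN : N ≤ m) : SpacedPath N e w e' := by
  induction h with
  | nil e => exact .nil e
  | @cons e e' e'' a w hs _ ih =>
    simp only [List.length_append, List.length_cons, xpow, List.length_replicate] at hw
    refine .cons ?_ (ih (by omega))
    cases e <;> cases e' <;> simp only [Spacing] at hs ⊢ <;> omega

theorem SpacedPath.exists_isLoop {m : ℕ} {e : Bool} {w : List (Fin 2 × Bool)}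
    (h : SpacedPath m e w e) (hm : 1 ≤ m) : ∃ M ≤ w.length, PathState.IsLoop M w := by
  have hmem : ∀ M, PathState.ofSign e ∈ PathState.reachable M := by
    intro M
    cases e <;> simp [PathState.ofSign, PathState.reachable]
  obtain h1 | h1 := le_or_gt m (w.length + 1)
  · obtain ⟨M, rfl⟩ : ∃ M, m = M + 1 := ⟨m - 1, by omega⟩
    exact ⟨M, by omega, _, hmem M, h.run_eq⟩
  · exact ⟨w.length, le_rfl, _, hmem _, (h.mono (Nat.le_succ _) h1.le).run_eq⟩

theorem norm_lift_le {g : Fin 2 → FG 2} (hg : ∀ i, (g i).norm ≤ 1) (u : FG 2) :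
    (lift g u).norm ≤ u.norm := by
  have key : ∀ L : List (Fin 2 × Bool), (lift g (mk L)).norm ≤ L.length := by
    intro L
    induction L with
    | nil => simp [← one_eq_mk]
    | cons l L ih =>
      rw [← List.singleton_append, ← mul_mk, _root_.map_mul]
      refine (norm_mul_le _ _).trans ?_
      have : (lift g (mk [l])).norm ≤ 1 := by
        obtain ⟨i, _ | _⟩ := l <;> simpa [norm_inv_eq] using hg i
      simp only [List.length_append, List.length_singleton]
      omega
  simpa [mk_toWord, norm] using key u.toWord

theorem norm_apply_of_mem_signedPerm {s : MulAut (FG 2)} (hs : s ∈ signedPerm) (u : FG 2) :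
    (s u).norm = u.norm := by
  revert u
  induction hs using Subgroup.closure_induction with
  | mem s hs =>
    have key : ∀ u, (s u).norm ≤ u.norm ∧ s (s u) = u := by
      rcases hs with rfl | rfl
      · have h2 : swapAut * swapAut = 1 := by apply mulAut_ext <;> simp
        refine fun u => ⟨norm_lift_le (fun i => ?_) u, DFunLike.congr_fun h2 u⟩
        fin_cases i <;> simp
      · have h2 : invAut * invAut = 1 := by apply mulAut_ext <;> simp
        refine fun u => ⟨norm_lift_le (fun i => ?_) u, DFunLike.congr_fun h2 u⟩
        fin_cases i <;> simp [norm_inv_eq]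
    intro u
    refine le_antisymm (key u).1 ?_
    simpa [(key u).2] using (key (s u)).1
  | one => simp
  | mul s t _ _ hs ht => simp [hs, ht]
  | inv s _ hs =>
    intro u
    simpa using (hs (s⁻¹ u)).symm

theorem exists_eq_lift_of_mem_signedPerm {s : MulAut (FG 2)} (hs : s ∈ signedPerm) :
    ∃ f : Fin 2 → Fin 2 × Bool, ∀ u, s u = lift (fun i => mk [f i]) u := by
  have h : ∀ i, ∃ l, s (of i) = mk [l] := by
    intro i
    have h1 := norm_apply_of_mem_signedPerm hs (of i)
    rw [norm_of, norm, List.length_eq_one_iff] at h1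
    obtain ⟨l, hl⟩ := h1
    exact ⟨l, by rw [← hl, mk_toWord]⟩
  choose f hf using h
  have : s.toMonoidHom = lift (fun i => mk [f i]) := by
    ext i
    simpa using hf i
  exact ⟨f, fun u => DFunLike.congr_fun this u⟩

open PathState

theorem exists_run_of_potentiallyPositive {u : FG 2} (hu : ∃ α : FG 2 ≃* FG 2, Positive (α u)) :
    ∃ (f : Fin 2 → Fin 2 × Bool) (M : ℕ) (k c : List (Fin 2 × Bool)), ∃ s ∈ reachable M,
      M ≤ u.norm ∧ 2 * k.length + c.length = u.norm ∧ run M s c = some s ∧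
        lift (fun i => mk [f i]) (mk (k ++ c ++ invRev k)) = u := by
  obtain ⟨s, hs, h, m, hm, e, w, hw, rfl⟩ := exists_spacedPath_of_potentiallyPositive hu
  obtain ⟨f, hf⟩ := exists_eq_lift_of_mem_signedPerm hs
  obtain ⟨M, hM, hl⟩ := hw.exists_isLoop hm
  obtain ⟨k, c, ⟨t, ht, hc⟩, h1, h2, h3⟩ :=
    hl.exists_isReduced_conj (k := h.toWord) isReduced_toWord
  have h4 : h * mk w * h⁻¹ = mk (k ++ c ++ invRev k) := by
    rw [← h3, ← mul_mk, ← mul_mk, ← inv_mk, mk_toWord]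
  have h5 : (s (h * mk w * h⁻¹)).norm = 2 * k.length + c.length := by
    rw [norm_apply_of_mem_signedPerm hs, h4, norm_mk_of_isReduced h2]
    simp only [List.length_append, invRev_length]
    omega
  exact ⟨f, M, k, c, t, ht, by omega, h5.symm, hc, by rw [h4, hf]⟩

/-- The words of length `n` on the letters `x ^ ±1`, `y ^ ±1`. -/
def wordsOfLength (n : ℕ) : Finset (List (Fin 2 × Bool)) :=
  Finset.univ.image (List.ofFn : (Fin n → Fin 2 × Bool) → List (Fin 2 × Bool))

theorem mem_wordsOfLength (w : List (Fin 2 × Bool)) : w ∈ wordsOfLength w.length :=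
  Finset.mem_image.2 ⟨w.get, Finset.mem_univ _, List.ofFn_get w⟩

theorem card_wordsOfLength_le (n : ℕ) : (wordsOfLength n).card ≤ 4 ^ n := by
  refine Finset.card_image_le.trans ?_
  simp

/-- A finite set containing all potentially positive elements of length `n`. -/
def candidates (n : ℕ) : Finset (FG 2) :=
  (Finset.univ : Finset (Fin 2 → Fin 2 × Bool)).biUnion fun f =>
    (Finset.range (n + 1)).biUnion fun M => (reachable M).biUnion fun s =>
      (Finset.range (n / 2 + 1)).biUnion fun j =>
        (wordsOfLength j ×ˢ accepted M (n - 2 * j) s).image fun p =>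
          lift (fun i => mk [f i]) (mk (p.1 ++ p.2 ++ invRev p.1))

theorem mem_candidates {u : FG 2} (hu : ∃ α : FG 2 ≃* FG 2, Positive (α u)) :
    u ∈ candidates u.norm := by
  obtain ⟨f, M, k, c, s, hs, h1, h2, h3, h4⟩ := exists_run_of_potentiallyPositive hu
  simp only [candidates, Finset.mem_biUnion, Finset.mem_image, Finset.mem_product]
  have hc := mem_accepted_of_run h3
  rw [show c.length = u.norm - 2 * k.length by omega] at hc
  exact ⟨f, Finset.mem_univ _, M, Finset.mem_range.2 (by omega), s, hs, k.length,
    Finset.mem_range.2 (by omega), (k, c), ⟨mem_wordsOfLength k, hc⟩, h4⟩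

theorem card_biUnion_le_mul_real {ι α : Type*} [DecidableEq α] (s : Finset ι) (f : ι → Finset α)
    {B : ℝ} (h : ∀ a ∈ s, ((f a).card : ℝ) ≤ B) : ((s.biUnion f).card : ℝ) ≤ s.card * B := by
  refine (Nat.cast_le.2 Finset.card_biUnion_le).trans ?_
  rw [Nat.cast_sum, ← nsmul_eq_mul]
  exact Finset.sum_le_card_nsmul _ _ _ h

theorem card_candidates_le {lam : ℝ} (h1 : 5 / 2 ≤ lam) (h2 : lam ≤ 63 / 25)
    (hroot : lam ^ 4 - 3 * lam ^ 3 + lam ^ 2 + lam - 1 = 0) (n : ℕ) :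
    ((candidates n).card : ℝ) ≤ 1920 * ((n + 1 : ℕ) ^ 3 * lam ^ n) := by
  have hlam : 0 < lam := by linarith
  have hn : 0 < lam ^ n := by positivity
  have hw : ((candidates n).card : ℝ) ≤ (Finset.univ : Finset (Fin 2 → Fin 2 × Bool)).card *
      ((Finset.range (n + 1)).card * ((5 * (n + 1) : ℕ) * ((Finset.range (n / 2 + 1)).card *
        (24 * lam ^ n)))) := by
    refine card_biUnion_le_mul_real _ _ fun f _ => card_biUnion_le_mul_real _ _ fun M hM => ?_
    refine (card_biUnion_le_mul_real (reachable M) _ fun s _ => card_biUnion_le_mul_real _ _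
      fun j hj => ?_).trans (mul_le_mul_of_nonneg_right (Nat.cast_le.2 ?_) (by positivity))
    · have hj' : j + j + (n - 2 * j) = n := by
        have := Finset.mem_range.1 hj
        omega
      refine (Nat.cast_le.2 Finset.card_image_le).trans ?_
      rw [Finset.card_product, Nat.cast_mul]
      have h4 : ((wordsOfLength j).card : ℝ) ≤ 4 ^ j := by exact_mod_cast card_wordsOfLength_le j
      calc ((wordsOfLength j).card : ℝ) * (accepted M (n - 2 * j) s).card
          ≤ (lam * lam) ^ j * (24 * lam ^ (n - 2 * j)) := by
            refine mul_le_mul (h4.trans ?_) (card_accepted_le h1 h2 hroot _ _ _) (by positivity)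
              (by positivity)
            exact pow_le_pow_left₀ (by norm_num) (by nlinarith) _
        _ = 24 * lam ^ (j + j + (n - 2 * j)) := by ring
        _ = 24 * lam ^ n := by rw [hj']
    · have := Finset.mem_range.1 hM
      exact (card_reachable_le M).trans (by omega)
  have hr : ((n / 2 + 1 : ℕ) : ℝ) ≤ (n + 1 : ℕ) := Nat.cast_le.2 (by omega)
  refine hw.trans ?_
  have hcard : (Finset.univ : Finset (Fin 2 → Fin 2 × Bool)).card = 16 := by simp
  rw [hcard, Finset.card_range, Finset.card_range]
  calc ((16 : ℕ) : ℝ) * ((n + 1 : ℕ) * ((5 * (n + 1) : ℕ) * ((n / 2 + 1 : ℕ) * (24 * lam ^ n))))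
      ≤ (16 : ℕ) * ((n + 1 : ℕ) * ((5 * (n + 1) : ℕ) * ((n + 1 : ℕ) * (24 * lam ^ n)))) := by
        gcongr
    _ = 1920 * ((n + 1 : ℕ) ^ 3 * lam ^ n) := by push_cast; ring

theorem le_root_and_root_le {lam : ℝ} (hroot : lam ^ 4 - 3 * lam ^ 3 + lam ^ 2 + lam - 1 = 0)
    (hmax : ∀ x : ℝ, x ^ 4 - 3 * x ^ 3 + x ^ 2 + x - 1 = 0 → x ≤ lam) :
    5 / 2 ≤ lam ∧ lam ≤ 63 / 25 := by
  constructor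
  · have hc : ContinuousOn (fun x : ℝ => x ^ 4 - 3 * x ^ 3 + x ^ 2 + x - 1)
        (Set.Icc (5 / 2) 3) := by fun_prop
    obtain ⟨x, hx, h0⟩ := intermediate_value_Icc (by norm_num) hc
      (show (0 : ℝ) ∈ Set.Icc _ _ by norm_num)
    exact hx.1.trans (hmax x h0)
  · by_contra! h
    have h1 : 0 < lam - 63 / 25 := by linarith
    obtain ⟨t, rfl⟩ : ∃ t, lam = t + 63 / 25 := ⟨lam - 63 / 25, by ring⟩
    have h2 : 0 < t := by linarith
    nlinarith [pow_pos h2 2, pow_pos h2 3, pow_pos h2 4]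

theorem exists_pow_mul_pow_le {a b : ℝ} (k : ℕ) (ha : 0 < a) (hab : a < b) :
    ∃ C : ℝ, ∀ n : ℕ, ((n + 1 : ℕ) : ℝ) ^ k * a ^ n ≤ C * b ^ n := by
  have hb : 0 < b := ha.trans hab
  have h := tendsto_pow_const_mul_const_pow_of_abs_lt_one k (r := a / b)
    (by rw [abs_of_pos (by positivity)]; exact (div_lt_one hb).2 hab)
  obtain ⟨C, hC⟩ := h.bddAbove_range
  refine ⟨C * (b / a), fun n => ?_⟩
  have h1 := hC ⟨n + 1, rfl⟩
  simp only [div_pow] at h1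
  rw [← mul_div_assoc, div_le_iff₀ (by positivity)] at h1
  have h2 : ((n + 1 : ℕ) : ℝ) ^ k * a ^ n = ((n + 1 : ℕ) : ℝ) ^ k * a ^ (n + 1) / a := by
    field_simp
    ring
  rw [h2, div_le_iff₀ ha]
  refine h1.trans (le_of_eq ?_)
  field_simp
  ring

end FreeGroup

/-- Let `λ` be the largest real root of `λ⁴ − 3λ³ + λ² + λ − 1`
(`λ ≈ 2.505`).  For every `ε > 0` there is `C > 0` such that the number of potentially
positive elements of `F_2` of reduced length `n` is at most `C (λ + ε)^n`. -/
theorem count_potentially_positive_F2 (lam : ℝ)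
    (hroot : lam ^ 4 - 3 * lam ^ 3 + lam ^ 2 + lam - 1 = 0)
    (hmax : ∀ x : ℝ, x ^ 4 - 3 * x ^ 3 + x ^ 2 + x - 1 = 0 → x ≤ lam) :
    ∀ ε : ℝ, 0 < ε → ∃ C : ℝ, 0 < C ∧ ∀ n : ℕ,
      (Nat.card {u : FG 2 | (∃ α : FG 2 ≃* FG 2, Positive (α u)) ∧ wordLength u = n} : ℝ)
        ≤ C * (lam + ε) ^ n := by
  intro ε hε
  obtain ⟨h1, h2⟩ := FreeGroup.le_root_and_root_le hroot hmax
  have hlam : 0 < lam := by linarith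
  obtain ⟨C, hC⟩ := FreeGroup.exists_pow_mul_pow_le 3 hlam (lt_add_of_pos_right lam hε)
  refine ⟨1920 * max C 1, by positivity, fun n => ?_⟩
  have hsub : {u : FG 2 | (∃ α : FG 2 ≃* FG 2, Positive (α u)) ∧ wordLength u = n} ⊆
      (FreeGroup.candidates n : Set (FG 2)) := by
    rintro u ⟨hu, rfl⟩
    exact FreeGroup.mem_candidates hu
  have hcard : Nat.card {u : FG 2 | (∃ α : FG 2 ≃* FG 2, Positive (α u)) ∧ wordLength u = n} ≤
      (FreeGroup.candidates n).card := by
    rw [Nat.card_coe_set_eq, ← Set.ncard_coe_finset]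
    exact Set.ncard_le_ncard hsub (Finset.finite_toSet _)
  calc _ ≤ ((FreeGroup.candidates n).card : ℝ) := Nat.cast_le.2 hcard
    _ ≤ 1920 * ((n + 1 : ℕ) ^ 3 * lam ^ n) := FreeGroup.card_candidates_le h1 h2 hroot n
    _ ≤ 1920 * (C * (lam + ε) ^ n) :=
      mul_le_mul_of_nonneg_left (hC n) (by norm_num)
    _ ≤ 1920 * (max C 1 * (lam + ε) ^ n) := by gcongr; exact le_max_left _ _
    _ = 1920 * max C 1 * (lam + ε) ^ n := by ring
end

section
/- Let u ∈ F_2 have reduced word ℓ_1 ℓ_2 ⋯ ℓ_n, and let u^R ∈ F_2 be the element whose reduced word is the reversal ℓ_n ⋯ ℓ_2 ℓ_1 (the reversal of a reduced word is reduced). Then u and u^R are translation equivalent: for every automorphism φ of F_2, ‖φ(u)‖ = ‖φ(u^R)‖. -/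
section FrickeTrace

variable {R : Type*} [CommRing R]

/-- `X` and `Y` correspond under the formal anti-involution of the algebra generated by the
`2 × 2` matrices `A` and `B` which fixes `A` and `B`. -/
def ReversalPair (A B X Y : Matrix (Fin 2) (Fin 2) R) : Prop :=
  ∃ a b c d : R, X = a • 1 + b • A + c • B + d • (A * B) ∧
    Y = a • 1 + b • A + c • B + d • (B * A)

namespace ReversalPair

variable {A B X Y X' Y' : Matrix (Fin 2) (Fin 2) R}

theorem one : ReversalPair A B 1 1 := ⟨1, 0, 0, 0, by simp, by simp⟩

theorem trace_eq (h : ReversalPair A B X Y) : X.trace = Y.trace := by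
  obtain ⟨a, b, c, d, rfl, rfl⟩ := h
  simp [Matrix.trace_mul_comm B A]

theorem sub (h : ReversalPair A B X Y) (h' : ReversalPair A B X' Y') :
    ReversalPair A B (X - X') (Y - Y') := by
  obtain ⟨a, b, c, d, rfl, rfl⟩ := h
  obtain ⟨a', b', c', d', rfl, rfl⟩ := h'
  exact ⟨a - a', b - b', c - c', d - d', by module, by module⟩

theorem smul (r : R) (h : ReversalPair A B X Y) : ReversalPair A B (r • X) (r • Y) := by
  obtain ⟨a, b, c, d, rfl, rfl⟩ := h
  exact ⟨r * a, r * b, r * c, r * d, by module, by module⟩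

theorem mul_left (h : ReversalPair A B X Y) : ReversalPair A B (A * X) (Y * A) := by
  obtain ⟨a, b, c, d, rfl, rfl⟩ := h
  refine ⟨-(b * A.det), a + b * A.trace, -(d * A.det), c + d * A.trace, ?_, ?_⟩ <;>
  · ext i j
    fin_cases i <;> fin_cases j <;>
      simp [Matrix.mul_apply, Fin.sum_univ_two, Matrix.det_fin_two, Matrix.trace_fin_two] <;> ring

theorem mul_right (h : ReversalPair A B X Y) : ReversalPair A B (B * X) (Y * B) := by
  obtain ⟨a, b, c, d, rfl, rfl⟩ := h
  refine ⟨b * ((A * B).trace - A.trace * B.trace) - c * B.det - d * (A.trace * B.det),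
    b * B.trace + d * B.det, a + b * A.trace + c * B.trace + d * (A * B).trace, -b, ?_, ?_⟩ <;>
  · ext i j
    fin_cases i <;> fin_cases j <;>
      simp [Matrix.mul_apply, Fin.sum_univ_two, Matrix.det_fin_two, Matrix.trace_fin_two] <;> ring

end ReversalPair

theorem adjugate_eq_trace_smul_one_sub (A : Matrix (Fin 2) (Fin 2) R) :
    A.adjugate = A.trace • 1 - A := by
  rw [Matrix.adjugate_fin_two]
  ext i j
  fin_cases i <;> fin_cases j <;> simp [Matrix.trace_fin_two]

theorem reversalPair_map_mk_reverse (f : FG 2 →* Matrix (Fin 2) (Fin 2) R)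
    (L : List (Fin 2 × Bool)) :
    ReversalPair (f (FreeGroup.of 0)) (f (FreeGroup.of 1))
      (f (FreeGroup.mk L)) (f (FreeGroup.mk L.reverse)) := by
  induction L with
  | nil =>
    simp only [List.reverse_nil, ← FreeGroup.one_eq_mk, map_one]
    exact .one
  | cons l L ih =>
    have hl : FreeGroup.mk (l :: L) = FreeGroup.mk [l] * FreeGroup.mk L := by
      rw [FreeGroup.mul_mk]; rfl
    have hr : FreeGroup.mk (l :: L).reverse = FreeGroup.mk L.reverse * FreeGroup.mk [l] := by
      rw [FreeGroup.mul_mk, List.reverse_cons]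
    rw [hl, hr, map_mul, map_mul]
    obtain ⟨i, b⟩ := l
    have hgen : ReversalPair (f (FreeGroup.of 0)) (f (FreeGroup.of 1))
        (f (FreeGroup.of i) * f (FreeGroup.mk L))
        (f (FreeGroup.mk L.reverse) * f (FreeGroup.of i)) := by
      fin_cases i
      · exact ih.mul_left
      · exact ih.mul_right
    cases b with
    | true => exact hgen
    | false =>
      have hinv : f (FreeGroup.mk [(i, false)]) = (f (FreeGroup.of i))⁻¹ := by
        have h : FreeGroup.mk [(i, false)] = (FreeGroup.of i)⁻¹ := rfl
        rw [h, Matrix.inv_eq_left_inv (by rw [← map_mul, inv_mul_cancel, map_one])]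
      simp only [hinv, Matrix.inv_def, adjugate_eq_trace_smul_one_sub, sub_mul, mul_sub,
        smul_mul_assoc, mul_smul_comm, one_mul, mul_one]
      exact ((ih.smul _).sub hgen).smul _

theorem trace_map_reverse (f : FG 2 →* Matrix (Fin 2) (Fin 2) R) (u : FG 2) :
    (f u).trace = (f (FreeGroup.mk u.toWord.reverse)).trace := by
  simpa only [FreeGroup.mk_toWord] using (reversalPair_map_mk_reverse f u.toWord).trace_eq

end FrickeTrace

theorem exists_wordLength_conj_eq_cyclicLength {r : ℕ} (u : FG r) :
    ∃ g : FG r, wordLength (g * u * g⁻¹) = cyclicLength u :=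
  Nat.sInf_mem (Set.range_nonempty fun g : FG r => wordLength (g * u * g⁻¹))

theorem cyclicLength_le {r : ℕ} (u g : FG r) : cyclicLength u ≤ wordLength (g * u * g⁻¹) :=
  Nat.sInf_le ⟨g, rfl⟩

/-- Every element has a cyclically reduced conjugate realizing its cyclic length. -/
theorem exists_isCyclicallyReduced_conj {r : ℕ} (u : FG r) :
    ∃ g : FG r, ((g * u * g⁻¹).toWord).length = cyclicLength u ∧
      FreeGroup.IsCyclicallyReduced (g * u * g⁻¹).toWord := by
  obtain ⟨g, hg⟩ := exists_wordLength_conj_eq_cyclicLength u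
  refine ⟨g, hg, ?_⟩
  set v := g * u * g⁻¹ with hv
  set c := FreeGroup.reduceCyclically.conjugator v.toWord
  set w := FreeGroup.reduceCyclically v.toWord
  have hdec : c ++ w ++ FreeGroup.invRev c = v.toWord :=
    FreeGroup.reduceCyclically.conj_conjugator_reduceCyclically _
  have hmk : FreeGroup.mk c * FreeGroup.mk w * (FreeGroup.mk c)⁻¹ = v := by
    rw [FreeGroup.inv_mk, FreeGroup.mul_mk, FreeGroup.mul_mk, hdec, FreeGroup.mk_toWord]
  have hw : FreeGroup.mk w = ((FreeGroup.mk c)⁻¹ * g) * u * ((FreeGroup.mk c)⁻¹ * g)⁻¹ := by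
    have : FreeGroup.mk w = (FreeGroup.mk c)⁻¹ * v * FreeGroup.mk c := by rw [← hmk]; group
    rw [this, hv]; group
  have hle : v.toWord.length ≤ w.length :=
    calc v.toWord.length = cyclicLength u := hg
      _ ≤ wordLength (FreeGroup.mk w) := hw ▸ cyclicLength_le u _
      _ ≤ w.length := FreeGroup.norm_mk_le
  have hc : c = [] := by
    have := congrArg List.length hdec
    simp only [List.length_append] at this
    exact List.eq_nil_of_length_eq_zero (by omega)
  have : w = v.toWord := by simpa [hc] using hdec
  rw [← this]
  exact FreeGroup.reduceCyclically.isCyclicallyReduced FreeGroup.isReduced_toWord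

section Schottky

open Matrix Filter Topology

/-- A vector spanning the attracting line of a letter in the Schottky representation. -/
def attractingVec : Fin 2 × Bool → Fin 2 → ℝ
  | (0, true) => ![1, 0]
  | (0, false) => ![0, 1]
  | (1, true) => ![1, 1]
  | (1, false) => ![1, 2]

/-- A covector whose kernel is the repelling line of a letter in the Schottky representation. -/
def repellingCovec : Fin 2 × Bool → Fin 2 → ℝ
  | (0, true) => ![1, 0]
  | (0, false) => ![0, 1]
  | (1, true) => ![2, -1]
  | (1, false) => ![-1, 1]

theorem repellingCovec_dotProduct_ne_zero (l m : Fin 2 × Bool) (h : l.1 = m.1 → l.2 = m.2) :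
    repellingCovec l ⬝ᵥ attractingVec m ≠ 0 := by
  obtain ⟨i, b⟩ := l
  obtain ⟨j, b'⟩ := m
  fin_cases i <;> fin_cases j <;> cases b <;> cases b' <;>
    simp [repellingCovec, attractingVec] at h ⊢ <;> norm_num

/-- The projection onto the attracting line of a letter along its repelling line. -/
def letterProj (l : Fin 2 × Bool) : Matrix (Fin 2) (Fin 2) ℝ :=
  vecMulVec (attractingVec l) (repellingCovec l)

/-- The matrix of a letter, with attracting eigenvalue `exp x`. -/
noncomputable def letterMatrix (x : ℝ) (l : Fin 2 × Bool) : Matrix (Fin 2) (Fin 2) ℝ :=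
  Real.exp x • letterProj l + Real.exp (-x) • letterProj (l.1, !l.2)

theorem letterMatrix_mul_letterMatrix_inv (x : ℝ) (l : Fin 2 × Bool) :
    letterMatrix x l * letterMatrix x (l.1, !l.2) = 1 := by
  have h : Real.exp x * Real.exp (-x) = 1 := by rw [← Real.exp_add]; simp
  obtain ⟨i, b⟩ := l
  ext j k
  fin_cases i <;> cases b <;> fin_cases j <;> fin_cases k <;>
    simp [letterMatrix, letterProj, attractingVec, repellingCovec, Matrix.mul_apply] <;>
    grind

/-- A one-parameter family of Schottky representations of `F_2`. -/
noncomputable def schottkyRep (x : ℝ) : FG 2 →* Matrix (Fin 2) (Fin 2) ℝ :=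
  (Units.coeHom _).comp <| FreeGroup.lift fun i =>
    ⟨letterMatrix x (i, true), letterMatrix x (i, false),
      letterMatrix_mul_letterMatrix_inv x (i, true), letterMatrix_mul_letterMatrix_inv x (i, false)⟩

theorem schottkyRep_mk (x : ℝ) (L : List (Fin 2 × Bool)) :
    schottkyRep x (FreeGroup.mk L) = (L.map (letterMatrix x)).prod := by
  induction L with
  | nil => simp [← FreeGroup.one_eq_mk]
  | cons l L ih =>
    have hl : FreeGroup.mk (l :: L) = FreeGroup.mk [l] * FreeGroup.mk L := by
      rw [FreeGroup.mul_mk]; rfl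
    rw [hl, map_mul, ih, List.map_cons, List.prod_cons]
    congr 1
    obtain ⟨i, b⟩ := l
    cases b <;> simp [schottkyRep]

theorem tendsto_letterMatrix (l : Fin 2 × Bool) :
    Tendsto (fun x => Real.exp (-x) • letterMatrix x l) atTop (𝓝 (letterProj l)) := by
  have h0 : Tendsto (fun x : ℝ => Real.exp (-x)) atTop (𝓝 0) :=
    Real.tendsto_exp_neg_atTop_nhds_zero
  have h : Tendsto (fun x : ℝ => letterProj l + (Real.exp (-x) * Real.exp (-x)) •
      letterProj (l.1, !l.2)) atTop (𝓝 (letterProj l + ((0 : ℝ) * 0) • letterProj (l.1, !l.2))) :=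
    tendsto_const_nhds.add ((h0.mul h0).smul_const _)
  convert h using 2 with x
  · rw [letterMatrix, smul_add, smul_smul, smul_smul, ← Real.exp_add]
    simp
  · simp

theorem tendsto_prod_letterMatrix (L : List (Fin 2 × Bool)) :
    Tendsto (fun x => Real.exp (-x) ^ L.length • (L.map (letterMatrix x)).prod) atTop
      (𝓝 (L.map letterProj).prod) := by
  induction L with
  | nil => simp
  | cons l L ih =>
    convert (tendsto_letterMatrix l).mul ih using 2 with x
    · rw [List.map_cons, List.prod_cons, smul_mul_smul_comm, List.length_cons, pow_succ']
    · simp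

theorem exists_prod_letterProj_eq (l : Fin 2 × Bool) (L : List (Fin 2 × Bool))
    (h : FreeGroup.IsReduced (l :: L)) :
    ∃ c : ℝ, c ≠ 0 ∧ ((l :: L).map letterProj).prod =
      c • vecMulVec (attractingVec l) (repellingCovec ((l :: L).getLast (by simp))) := by
  induction L generalizing l with
  | nil => exact ⟨1, one_ne_zero, by simp [letterProj]⟩
  | cons m L ih =>
    rw [FreeGroup.IsReduced, List.isChain_cons_cons] at h
    obtain ⟨c, hc, hprod⟩ := ih m h.2
    refine ⟨c * (repellingCovec l ⬝ᵥ attractingVec m),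
      mul_ne_zero hc (repellingCovec_dotProduct_ne_zero l m h.1), ?_⟩
    rw [List.map_cons, List.prod_cons, hprod, letterProj, mul_smul_comm,
      vecMulVec_mul_vecMulVec, vecMulVec_smul, smul_smul, List.getLast_cons (List.cons_ne_nil m L)]

theorem trace_prod_letterProj_ne_zero (L : List (Fin 2 × Bool))
    (h : FreeGroup.IsCyclicallyReduced L) : (L.map letterProj).prod.trace ≠ 0 := by
  cases L with
  | nil => simp
  | cons l L =>
    obtain ⟨c, hc, hprod⟩ := exists_prod_letterProj_eq l L h.1
    rw [hprod, trace_smul, trace_vecMulVec, dotProduct_comm]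
    exact mul_ne_zero hc (repellingCovec_dotProduct_ne_zero _ _
      (h.2 _ (List.getLast?_eq_some_getLast (by simp)) _ rfl))

/-- The cyclic length is the exponential growth rate of the trace of the Schottky
representations. -/
theorem exists_tendsto_trace_schottkyRep (u : FG 2) :
    ∃ c : ℝ, c ≠ 0 ∧ Tendsto
      (fun x => Real.exp (-x) ^ cyclicLength u * (schottkyRep x u).trace) atTop (𝓝 c) := by
  obtain ⟨g, hlen, hred⟩ := exists_isCyclicallyReduced_conj u
  refine ⟨_, trace_prod_letterProj_ne_zero _ hred, ?_⟩
  refine (((continuous_id.matrix_trace).tendsto _).comp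
    (tendsto_prod_letterMatrix (g * u * g⁻¹).toWord)).congr fun x => ?_
  simp only [Function.comp_apply, id_eq, trace_smul, smul_eq_mul, ← schottkyRep_mk,
    FreeGroup.mk_toWord, hlen]
  rw [map_mul, trace_mul_comm, ← map_mul, inv_mul_cancel_left]

theorem le_of_tendsto_exp_neg_pow_mul {f : ℝ → ℝ} {m n : ℕ} {c d : ℝ} (hc : c ≠ 0)
    (hm : Tendsto (fun x => Real.exp (-x) ^ m * f x) atTop (𝓝 c))
    (hn : Tendsto (fun x => Real.exp (-x) ^ n * f x) atTop (𝓝 d)) : m ≤ n := by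
  by_contra! hlt
  have h0 : Tendsto (fun x : ℝ => Real.exp (-x) ^ (m - n)) atTop (𝓝 0) := by
    simpa [(Nat.sub_pos_of_lt hlt).ne'] using Real.tendsto_exp_neg_atTop_nhds_zero.pow (m - n)
  refine hc (tendsto_nhds_unique hm ?_)
  convert h0.mul hn using 2 with x
  · rw [← mul_assoc, ← pow_add, Nat.sub_add_cancel hlt.le]
  · simp

theorem cyclicLength_eq_of_trace_eq {u v : FG 2}
    (h : ∀ x, (schottkyRep x u).trace = (schottkyRep x v).trace) :
    cyclicLength u = cyclicLength v := by
  obtain ⟨c, hc, hu⟩ := exists_tendsto_trace_schottkyRep u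
  obtain ⟨d, hd, hv⟩ := exists_tendsto_trace_schottkyRep v
  simp only [h] at hu
  exact le_antisymm (le_of_tendsto_exp_neg_pow_mul hc hu hv)
    (le_of_tendsto_exp_neg_pow_mul hd hv hu)

end Schottky

/-- Every `u ∈ F_2` is translation equivalent to the element `u^R`
whose reduced word is the reversal of the reduced word of `u`: for every automorphism
`φ` of `F_2`, the cyclic lengths of `φ(u)` and `φ(u^R)` agree. -/
theorem translation_equivalent_reverse (u : FG 2) :
    ∀ φ : FG 2 ≃* FG 2,
      cyclicLength (φ u) = cyclicLength (φ (FreeGroup.mk u.toWord.reverse)) := by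
  intro φ
  exact cyclicLength_eq_of_trace_eq fun x =>
    trace_map_reverse ((schottkyRep x).comp φ.toMonoidHom) u
end
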